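/- arXiv:2601.10730 — 15 statements merged into one kernel-verified Lean document; each statement's English description precedes it below -/
import Mathlib

section
/- Assume a ≠ 0 (the non-unimodular case). Then there exist a real number c and a derivation D of g such that Ric = c·id_g + D if and only if f(a) = 0 and f∘f∘f = -(2‖a‖² + ¼·tr(f∘f))·f; moreover, in that case necessarily c = -‖a‖² < 0, so the algebraic Ricci soliton is expanding. -/
open scoped RealInnerProductSpace

/-- in the non-unimodular case (`a ≠ 0`), `(g, ⟨·,·⟩)` is an algebraic Ricci
soliton iff `f a = 0` and `f³ = -(2‖a‖² + ¼ tr(f²)) f`; moreover necessarily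
`c = -‖a‖² < 0` (an expanding soliton). -/
theorem stmt_2
    {g : Type*} [NormedAddCommGroup g] [InnerProductSpace ℝ g] [FiniteDimensional ℝ g]
    (bra : g →ₗ[ℝ] g →ₗ[ℝ] g)
    (hbra_alt : ∀ x : g, bra x x = 0)
    (hbra_jac : ∀ x y z : g, bra (bra x y) z + bra (bra y z) x + bra (bra z x) y = 0)
    (e : g) (he : ‖e‖ = 1)
    (hder : Submodule.span ℝ {z : g | ∃ x y : g, z = bra x y} = Submodule.span ℝ {e})
    (Γ : Submodule ℝ g) (hΓ : Γ = (Submodule.span ℝ {e})ᗮ)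
    (a : Γ) (ha : ∀ u : Γ, bra u e = ⟪(a : g), (u : g)⟫ • e)
    (f : ↥Γ →ₗ[ℝ] ↥Γ)
    (hf_skew : ∀ u v : Γ, ⟪(f u : g), (v : g)⟫ = -⟪(u : g), (f v : g)⟫)
    (hf : ∀ u v : Γ, bra u v = ⟪(f u : g), (v : g)⟫ • e)
    (Ric : g →ₗ[ℝ] g)
    (hRic_e : Ric e = -(f a : g) -
      ((1 / 4) * LinearMap.trace ℝ ↥Γ (f ∘ₗ f) + ‖(a : g)‖ ^ 2) • e)
    (hRic_u : ∀ u : Γ, Ric u = (1 / 2 : ℝ) • (f (f u) : g)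
      - ⟪(u : g), (a : g)⟫ • (a : g) + ⟪(f u : g), (a : g)⟫ • e)
    (hane : a ≠ 0) :
    ((∃ (c : ℝ) (D : g →ₗ[ℝ] g),
        (∀ x y : g, D (bra x y) = bra (D x) y + bra x (D y)) ∧
        Ric = c • (LinearMap.id : g →ₗ[ℝ] g) + D) ↔
      (f a = 0 ∧ f ∘ₗ f ∘ₗ f =
        (-(2 * ‖(a : g)‖ ^ 2 + (1 / 4) * LinearMap.trace ℝ ↥Γ (f ∘ₗ f))) • f)) ∧
    (∀ (c : ℝ) (D : g →ₗ[ℝ] g),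
      (∀ x y : g, D (bra x y) = bra (D x) y + bra x (D y)) →
      Ric = c • (LinearMap.id : g →ₗ[ℝ] g) + D →
      c = -‖(a : g)‖ ^ 2 ∧ c < 0) := by
  have hee : ⟪e, e⟫ = 1 := by rw [real_inner_self_eq_norm_sq, he]; norm_num
  have hene : e ≠ 0 := by rintro rfl; simp at he
  have hperp : ∀ u : Γ, ⟪e, (u : g)⟫ = 0 := by
    intro u
    have h : (u : g) ∈ (Submodule.span ℝ {e})ᗮ := hΓ.le u.2
    exact (Submodule.mem_orthogonal_singleton_iff_inner_right).1 h
  have hane' : (a : g) ≠ 0 := by simpa using hane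
  have hapos : 0 < ‖(a : g)‖ ^ 2 := by positivity
  have haa : ⟪(a : g), (a : g)⟫ = ‖(a : g)‖ ^ 2 := real_inner_self_eq_norm_sq _
  have hanti : ∀ x y : g, bra x y = - bra y x := by
    intro x y
    have h := hbra_alt (x + y)
    simp only [map_add, LinearMap.add_apply, hbra_alt, zero_add, add_zero] at h
    first
      | exact eq_neg_of_add_eq_zero_left h
      | exact eq_neg_of_add_eq_zero_right h
  have hdec : ∀ x : g, ∃ (u : Γ) (s : ℝ), x = u + s • e := by
    intro x
    refine ⟨⟨x - ⟪e, x⟫ • e, ?_⟩, ⟪e, x⟫, by simp⟩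
    rw [hΓ, Submodule.mem_orthogonal_singleton_iff_inner_right, inner_sub_right,
      inner_smul_right, hee]
    ring
  have hspan : ∀ x y : g, ∃ s : ℝ, bra x y = s • e := by
    intro x y
    have h : bra x y ∈ Submodule.span ℝ {e} := by
      rw [← hder]
      exact Submodule.subset_span ⟨x, y, rfl⟩
    obtain ⟨s, hs⟩ := Submodule.mem_span_singleton.1 h
    exact ⟨s, hs.symm⟩
  -- Jacobi forces `f = 0` as soon as `f a = 0`
  have hf0 : f a = 0 → f = 0 := by
    intro hfa
    have h1 : ∀ u v : Γ, ⟪(f u : g), (v : g)⟫ = 0 := by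
      intro u v
      have h := hbra_jac u v a
      have h2 : ⟪(f v : g), (a : g)⟫ = 0 := by rw [hf_skew, hfa]; simp
      rw [hf, hf, hf, h2, hfa] at h
      simp only [map_smul, LinearMap.smul_apply, hanti e, ha, haa] at h
      simp only [ZeroMemClass.coe_zero, inner_zero_left, zero_smul, add_zero, smul_neg, neg_zero,
        neg_eq_zero, smul_eq_zero] at h
      rcases h with h | h | h
      · exact h
      · exact absurd h hapos.ne'
      · exact absurd h hene
    ext u
    have := h1 u (f u)
    rw [inner_self_eq_zero] at this
    simpa using this
  have main : ∀ (c : ℝ) (D : g →ₗ[ℝ] g),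
      (∀ x y : g, D (bra x y) = bra (D x) y + bra x (D y)) →
      Ric = c • (LinearMap.id : g →ₗ[ℝ] g) + D → f a = 0 ∧ c = -‖(a : g)‖ ^ 2 := by
    intro c D hD hR
    have hDx : ∀ x, D x = Ric x - c • x := by
      intro x; rw [hR]; simp
    have hae := hD a e
    rw [ha, haa, map_smul] at hae
    have hfa : f a = 0 := by
      obtain ⟨s, hs⟩ := hspan (D a) e
      obtain ⟨t, ht⟩ := hspan a (D e)
      rw [hs, ht, hDx, hRic_e] at hae
      have h := congrArg (fun z => ⟪(f a : g), z⟫) hae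
      have h0 : ⟪(f a : g), e⟫ = 0 := by rw [real_inner_comm]; exact hperp _
      simp only [inner_smul_right, inner_sub_right, inner_neg_right, inner_add_right, h0,
        mul_zero, sub_zero, add_zero, mul_neg, neg_eq_zero, mul_eq_zero, hapos.ne', false_or,
        inner_self_eq_zero] at h
      simpa using h
    refine ⟨hfa, ?_⟩
    have hf' := hf0 hfa
    obtain ⟨l, hl⟩ : ∃ l : ℝ, D e = l • e := by
      refine ⟨-‖(a : g)‖ ^ 2 - c, ?_⟩
      rw [hDx, hRic_e, hf']
      simp [sub_smul]
    have hDa : D a = (-‖(a : g)‖ ^ 2 - c) • (a : g) := by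
      rw [hDx, hRic_u, hf', haa]
      simp [sub_smul]
    rw [hl, hDa] at hae
    simp only [map_smul, LinearMap.smul_apply, ha, haa, smul_smul] at hae
    rw [← add_smul] at hae
    have h := smul_left_injective ℝ hene hae
    have h3 : (-‖(a : g)‖ ^ 2 - c) * ‖(a : g)‖ ^ 2 = 0 := by
      linarith
    rcases mul_eq_zero.1 h3 with h4 | h4
    · linarith
    · exact absurd h4 hapos.ne'
  refine ⟨⟨?_, ?_⟩, ?_⟩
  · rintro ⟨c, D, hD, hR⟩
    have hfa := (main c D hD hR).1
    refine ⟨hfa, ?_⟩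
    rw [hf0 hfa]
    simp
  · rintro ⟨hfa, -⟩
    have hf' := hf0 hfa
    refine ⟨-‖(a : g)‖ ^ 2, Ric + ‖(a : g)‖ ^ 2 • LinearMap.id, ?_, ?_⟩
    · set D : g →ₗ[ℝ] g := Ric + ‖(a : g)‖ ^ 2 • LinearMap.id with hDdef
      have hDe : D e = 0 := by
        simp [hDdef, hRic_e, hf']
      have hDu : ∀ u : Γ, D u = ((‖(a : g)‖ ^ 2 • u - ⟪(u : g), (a : g)⟫ • a : Γ) : g) := by
        intro u
        simp [hDdef, hRic_u, hf']
        abel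
      have hz : ∀ x y : g, bra (D x) y = 0 := by
        intro x y
        obtain ⟨u, s, rfl⟩ := hdec x
        obtain ⟨v, t, rfl⟩ := hdec y
        rw [map_add D, map_smul D, hDe, hDu, smul_zero, add_zero, map_add, map_smul, hf, ha, hf']
        have : ⟪(a : g), ((‖(a : g)‖ ^ 2 • u - ⟪(u : g), (a : g)⟫ • a : Γ) : g)⟫ = 0 := by
          simp only [Submodule.coe_sub, Submodule.coe_smul, inner_sub_right, inner_smul_right,
            haa, real_inner_comm (u : g) (a : g)]
          ring
        rw [this]
        simp
      intro x y
      obtain ⟨s, hs⟩ := hspan x y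
      rw [hs, map_smul, hDe, hz, hanti x, hz]
      simp
    · ext x
      simp
  · intro c D hD hR
    have h := (main c D hD hR).2
    exact ⟨h, by linarith⟩
end

section
/- If there exist a real number c and a derivation D of g such that Ric = c·id_g + D, then f(a) = 0, i.e., a lies in the kernel of f. -/
open scoped RealInnerProductSpace

/-- if `Ric = c·id + D` for some real `c` and a derivation `D`, then
`a` lies in the kernel of `f`. -/
theorem stmt_3
    {g : Type*} [NormedAddCommGroup g] [InnerProductSpace ℝ g] [FiniteDimensional ℝ g]
    (bra : g →ₗ[ℝ] g →ₗ[ℝ] g)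
    (hbra_alt : ∀ x : g, bra x x = 0)
    (hbra_jac : ∀ x y z : g, bra (bra x y) z + bra (bra y z) x + bra (bra z x) y = 0)
    (e : g) (he : ‖e‖ = 1)
    (hder : Submodule.span ℝ {z : g | ∃ x y : g, z = bra x y} = Submodule.span ℝ {e})
    (Γ : Submodule ℝ g) (hΓ : Γ = (Submodule.span ℝ {e})ᗮ)
    (a : Γ) (ha : ∀ u : Γ, bra u e = ⟪(a : g), (u : g)⟫ • e)
    (f : ↥Γ →ₗ[ℝ] ↥Γ)
    (hf_skew : ∀ u v : Γ, ⟪(f u : g), (v : g)⟫ = -⟪(u : g), (f v : g)⟫)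
    (hf : ∀ u v : Γ, bra u v = ⟪(f u : g), (v : g)⟫ • e)
    (Ric : g →ₗ[ℝ] g)
    (hRic_e : Ric e = -(f a : g) -
      ((1 / 4) * LinearMap.trace ℝ ↥Γ (f ∘ₗ f) + ‖(a : g)‖ ^ 2) • e)
    (hRic_u : ∀ u : Γ, Ric u = (1 / 2 : ℝ) • (f (f u) : g)
      - ⟪(u : g), (a : g)⟫ • (a : g) + ⟪(f u : g), (a : g)⟫ • e)
    (c : ℝ) (D : g →ₗ[ℝ] g)
    (hD : ∀ x y : g, D (bra x y) = bra (D x) y + bra x (D y))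
    (hRicD : Ric = c • (LinearMap.id : g →ₗ[ℝ] g) + D) :
    f a = 0 := by
  have hDe : D e ∈ Submodule.span ℝ {e} := by
    have hee : e ∈ Submodule.span ℝ {z : g | ∃ x y : g, z = bra x y} := by
      rw [hder]; exact Submodule.mem_span_singleton_self e
    rw [← hder]
    have hle : Submodule.span ℝ {z : g | ∃ x y : g, z = bra x y} ≤
        (Submodule.span ℝ {z : g | ∃ x y : g, z = bra x y}).comap D := by
      refine Submodule.span_le.mpr ?_
      rintro z ⟨x, y, rfl⟩
      change D (bra x y) ∈ Submodule.span ℝ {z : g | ∃ x y : g, z = bra x y}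
      rw [hD]
      exact Submodule.add_mem _ (Submodule.subset_span ⟨_, _, rfl⟩)
        (Submodule.subset_span ⟨_, _, rfl⟩)
    exact hle hee
  obtain ⟨t, ht⟩ := Submodule.mem_span_singleton.mp hDe
  have h1 : Ric e = c • e + D e := by rw [hRicD]; simp
  have h2 : (f a : g) ∈ Submodule.span ℝ {e} := by
    rw [hRic_e, ← ht] at h1
    refine Submodule.mem_span_singleton.mpr
      ⟨-(c + t + ((1 / 4) * LinearMap.trace ℝ ↥Γ (f ∘ₗ f) + ‖(a : g)‖ ^ 2)), ?_⟩
    rw [neg_smul, add_smul, add_smul c t, ← h1]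
    abel
  have h3 : (f a : g) ∈ (Submodule.span ℝ {e})ᗮ := by
    have h := (f a).2
    exact hΓ.le h
  have h4 : ⟪(f a : g), (f a : g)⟫ = 0 := (Submodule.mem_orthogonal _ _).mp h3 _ h2
  exact Subtype.ext (inner_self_eq_zero.mp h4)
end

section
/- Assume a ≠ 0. If c is a real number and D is a derivation of g such that Ric = c·id_g + D, then c = -‖a‖² and f∘f∘f = -(2‖a‖² + ¼·tr(f∘f))·f. -/
open scoped RealInnerProductSpace

/-- assume `a ≠ 0`. If `Ric = c·id + D` for a derivation `D`, then
`c = -‖a‖²` and `f³ = -(2‖a‖² + ¼ tr(f²)) f`. -/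
theorem stmt_4
    {g : Type*} [NormedAddCommGroup g] [InnerProductSpace ℝ g] [FiniteDimensional ℝ g]
    (bra : g →ₗ[ℝ] g →ₗ[ℝ] g)
    (hbra_alt : ∀ x : g, bra x x = 0)
    (hbra_jac : ∀ x y z : g, bra (bra x y) z + bra (bra y z) x + bra (bra z x) y = 0)
    (e : g) (he : ‖e‖ = 1)
    (hder : Submodule.span ℝ {z : g | ∃ x y : g, z = bra x y} = Submodule.span ℝ {e})
    (Γ : Submodule ℝ g) (hΓ : Γ = (Submodule.span ℝ {e})ᗮ)
    (a : Γ) (ha : ∀ u : Γ, bra u e = ⟪(a : g), (u : g)⟫ • e)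
    (f : ↥Γ →ₗ[ℝ] ↥Γ)
    (hf_skew : ∀ u v : Γ, ⟪(f u : g), (v : g)⟫ = -⟪(u : g), (f v : g)⟫)
    (hf : ∀ u v : Γ, bra u v = ⟪(f u : g), (v : g)⟫ • e)
    (Ric : g →ₗ[ℝ] g)
    (hRic_e : Ric e = -(f a : g) -
      ((1 / 4) * LinearMap.trace ℝ ↥Γ (f ∘ₗ f) + ‖(a : g)‖ ^ 2) • e)
    (hRic_u : ∀ u : Γ, Ric u = (1 / 2 : ℝ) • (f (f u) : g)
      - ⟪(u : g), (a : g)⟫ • (a : g) + ⟪(f u : g), (a : g)⟫ • e)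
    (hane : a ≠ 0)
    (c : ℝ) (D : g →ₗ[ℝ] g)
    (hD : ∀ x y : g, D (bra x y) = bra (D x) y + bra x (D y))
    (hRicD : Ric = c • (LinearMap.id : g →ₗ[ℝ] g) + D) :
    c = -‖(a : g)‖ ^ 2 ∧ f ∘ₗ f ∘ₗ f =
      (-(2 * ‖(a : g)‖ ^ 2 + (1 / 4) * LinearMap.trace ℝ ↥Γ (f ∘ₗ f))) • f := by
  have hmem : ∀ x y : g, ∃ k : ℝ, k • e = bra x y := by
    intro x y
    have h : bra x y ∈ Submodule.span ℝ {e} := by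
      rw [← hder]
      exact Submodule.subset_span ⟨x, y, rfl⟩
    exact Submodule.mem_span_singleton.mp h
  have horth : ∀ u : Γ, ⟪e, (u : g)⟫ = 0 := by
    intro u
    have hu : (u : g) ∈ (Submodule.span ℝ {e})ᗮ := hΓ ▸ u.2
    exact Submodule.mem_orthogonal_singleton_iff_inner_right.mp hu
  have he0 : e ≠ 0 := by
    intro h
    rw [h, norm_zero] at he
    exact zero_ne_one he
  have hag : (a : g) ≠ 0 := fun h => hane (Subtype.ext h)
  have hN : ⟪(a : g), (a : g)⟫ ≠ 0 := inner_self_ne_zero.mpr hag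
  have hDx : ∀ x, D x = Ric x - c • x := by
    intro x
    rw [hRicD]
    simp
  -- `f a = 0`
  have hfa : f a = 0 := by
    have h1 := hD a e
    obtain ⟨k, hk⟩ := hmem (D a) e
    obtain ⟨l, hl⟩ := hmem a (D e)
    rw [ha a, map_smul, ← hk, ← hl, hDx e, hRic_e] at h1
    have h2 := congrArg (fun z => ⟪z, (f a : g)⟫) h1
    simp only [inner_add_left, inner_sub_left, inner_neg_left, real_inner_smul_left,
      horth (f a), mul_zero, sub_zero, add_zero] at h2
    have h3 : ⟪(f a : g), (f a : g)⟫ = 0 := by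
      rcases mul_eq_zero.mp h2 with h | h
      · exact absurd h hN
      · linarith
    exact Subtype.ext (inner_self_eq_zero.mp h3)
  have hanti : ∀ u : Γ, bra e u = -(⟪(a : g), (u : g)⟫ • e) := by
    intro u
    have h := hbra_alt (e + u)
    simp only [map_add, LinearMap.add_apply, hbra_alt, ha u, zero_add, add_zero] at h
    first
      | exact eq_neg_of_add_eq_zero_left h
      | exact eq_neg_of_add_eq_zero_right h
  -- the Jacobi identity forces `f = 0`
  have hf0 : f = 0 := by
    ext u
    have key : ∀ v : Γ, ⟪(f u : g), (v : g)⟫ = 0 := by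
      intro v
      have h := hbra_jac u v a
      have h4 : ⟪(f v : g), (a : g)⟫ = 0 := by rw [hf_skew, hfa]; simp
      rw [hf u v, hf v a, hf a u, h4, hfa] at h
      simp only [ZeroMemClass.coe_zero, inner_zero_left, zero_smul, map_zero,
        LinearMap.zero_apply, add_zero, map_smul, LinearMap.smul_apply, hanti,
        smul_neg, neg_eq_zero, smul_smul] at h
      rcases smul_eq_zero.mp h with h | h
      · exact (mul_eq_zero.mp h).resolve_right hN
      · exact absurd h he0
    simpa using inner_self_eq_zero.mp (key (f u))
  refine ⟨?_, by simp [hf0]⟩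
  have h1 := hD a e
  have hDa : D a = (-(⟪(a : g), (a : g)⟫ + c)) • (a : g) := by
    rw [hDx, hRic_u, hf0]
    simp only [LinearMap.zero_apply, ZeroMemClass.coe_zero, inner_zero_left]
    module
  obtain ⟨s, hs⟩ : ∃ s : ℝ, D e = s • e := by
    refine ⟨-((1 / 4) * LinearMap.trace ℝ ↥Γ (f ∘ₗ f) + ‖(a : g)‖ ^ 2) - c, ?_⟩
    rw [hDx, hRic_e, hfa, ZeroMemClass.coe_zero]
    module
  rw [ha a, map_smul, hDa, hs, map_smul, map_smul, LinearMap.smul_apply, ha a] at h1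
  have h2 : ((⟪(a : g), (a : g)⟫ + c) * ⟪(a : g), (a : g)⟫) • e = 0 := by
    linear_combination (norm := module) h1
  rcases smul_eq_zero.mp h2 with h | h
  · have h5 := (mul_eq_zero.mp h).resolve_right hN
    rw [real_inner_self_eq_norm_sq] at h5
    linarith
  · exact absurd h he0
end

section
/- Assume a = 0 (the unimodular case). Then for a real number c, the linear map D := Ric - c·id_g is a derivation of g (equivalently, (g,⟨·,·⟩) is an algebraic Ricci soliton with constant c) if and only if f∘f∘f = (c - ¼·tr(f∘f))·f. -/
open scoped RealInnerProductSpace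

/-- assume `a = 0` (the unimodular case). For a real number `c`, the map
`D := Ric - c·id` is a derivation of `g` iff `f³ = (c - ¼ tr(f²)) f`. -/
theorem stmt_5
    {g : Type*} [NormedAddCommGroup g] [InnerProductSpace ℝ g] [FiniteDimensional ℝ g]
    (bra : g →ₗ[ℝ] g →ₗ[ℝ] g)
    (hbra_alt : ∀ x : g, bra x x = 0)
    (hbra_jac : ∀ x y z : g, bra (bra x y) z + bra (bra y z) x + bra (bra z x) y = 0)
    (e : g) (he : ‖e‖ = 1)
    (hder : Submodule.span ℝ {z : g | ∃ x y : g, z = bra x y} = Submodule.span ℝ {e})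
    (Γ : Submodule ℝ g) (hΓ : Γ = (Submodule.span ℝ {e})ᗮ)
    (a : Γ) (ha : ∀ u : Γ, bra u e = ⟪(a : g), (u : g)⟫ • e)
    (f : ↥Γ →ₗ[ℝ] ↥Γ)
    (hf_skew : ∀ u v : Γ, ⟪(f u : g), (v : g)⟫ = -⟪(u : g), (f v : g)⟫)
    (hf : ∀ u v : Γ, bra u v = ⟪(f u : g), (v : g)⟫ • e)
    (Ric : g →ₗ[ℝ] g)
    (hRic_e : Ric e = -(f a : g) -
      ((1 / 4) * LinearMap.trace ℝ ↥Γ (f ∘ₗ f) + ‖(a : g)‖ ^ 2) • e)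
    (hRic_u : ∀ u : Γ, Ric u = (1 / 2 : ℝ) • (f (f u) : g)
      - ⟪(u : g), (a : g)⟫ • (a : g) + ⟪(f u : g), (a : g)⟫ • e)
    (ha0 : a = 0) (c : ℝ) :
    (∀ x y : g,
        (Ric - c • (LinearMap.id : g →ₗ[ℝ] g)) (bra x y) =
          bra ((Ric - c • (LinearMap.id : g →ₗ[ℝ] g)) x) y +
          bra x ((Ric - c • (LinearMap.id : g →ₗ[ℝ] g)) y)) ↔
      f ∘ₗ f ∘ₗ f = (c - (1 / 4) * LinearMap.trace ℝ ↥Γ (f ∘ₗ f)) • f := by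
  subst ha0
  set T := LinearMap.trace ℝ ↥Γ (f ∘ₗ f) with hT
  have hue : ∀ u : Γ, bra u e = 0 := fun u => by simpa using ha u
  have hanti : ∀ x y : g, bra x y = - bra y x := fun x y => by
    have h := hbra_alt (x + y)
    simp only [map_add, LinearMap.add_apply, hbra_alt, zero_add, add_zero] at h
    exact eq_neg_of_add_eq_zero_right h
  have heu : ∀ u : Γ, bra e u = 0 := fun u => by rw [hanti, hue, neg_zero]
  have he0 : e ≠ 0 := by
    rintro rfl
    simp at he
  have hRe : Ric e = -((1 / 4) * T) • e := by
    rw [hRic_e]; simp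
  have hRu : ∀ u : Γ, Ric u = (((1 / 2 : ℝ) • f (f u) : Γ) : g) := fun u => by
    rw [hRic_u]; simp
  have hdec : ∀ x : g, ∃ (s : ℝ) (u : Γ), x = s • e + (u : g) := fun x => by
    obtain ⟨y, hy, z, hz, h⟩ := (Submodule.span ℝ {e}).exists_add_mem_mem_orthogonal x
    obtain ⟨s, rfl⟩ := Submodule.mem_span_singleton.1 hy
    exact ⟨s, ⟨z, hΓ ▸ hz⟩, h⟩
  have hDe : (Ric - c • (LinearMap.id : g →ₗ[ℝ] g)) e = (-((1 / 4) * T) - c) • e := by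
    simp [hRe, sub_smul]
  have hDu : ∀ u : Γ, (Ric - c • (LinearMap.id : g →ₗ[ℝ] g)) u
      = (((1 / 2 : ℝ) • f (f u) - c • u : Γ) : g) := fun u => by
    simp [hRu]
  have hs : ∀ u v : Γ, ⟪(f u : g), (f (f v) : g)⟫ = ⟪(f (f (f u)) : g), (v : g)⟫ := fun u v => by
    rw [hf_skew (f (f u)) v, hf_skew (f u) (f v), neg_neg]
  have key : ∀ u v : Γ, ((Ric - c • (LinearMap.id : g →ₗ[ℝ] g)) (bra u v) =
          bra ((Ric - c • (LinearMap.id : g →ₗ[ℝ] g)) u) v +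
          bra u ((Ric - c • (LinearMap.id : g →ₗ[ℝ] g)) v)) ↔
      ⟪(f (f (f u)) : g), (v : g)⟫ = (c - (1 / 4) * T) * ⟪(f u : g), (v : g)⟫ := fun u v => by
    rw [hDu, hDu, hf, hf, hf, map_smul, hDe, smul_smul, ← add_smul]
    rw [(smul_left_injective ℝ he0).eq_iff]
    simp only [map_sub, map_smul, Submodule.coe_sub, Submodule.coe_smul, inner_sub_left,
      inner_sub_right, real_inner_smul_left, real_inner_smul_right, hs]
    constructor <;> intro h <;> linarith
  constructor
  · intro h
    ext1 u
    refine ext_inner_right ℝ fun v => ?_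
    have := (key u v).1 (h u v)
    simpa [real_inner_smul_left] using this
  · intro h x y
    obtain ⟨s, u, rfl⟩ := hdec x
    obtain ⟨t, v, rfl⟩ := hdec y
    have hk := (key u v).2 (by
      have h1 := congrArg (fun w : Γ => ⟪(w : g), (v : g)⟫) (LinearMap.congr_fun h u)
      simpa [real_inner_smul_left] using h1)
    rw [hDu, hDu] at hk
    simp only [map_add, map_smul, LinearMap.add_apply, LinearMap.smul_apply, hDe, hDu, hue, heu,
      hbra_alt, smul_zero, zero_add, add_zero, map_zero]
    exact hk
end

section
/- Let g be a finite-dimensional real Lie algebra whose derived algebra g¹ = [g,g] is two-dimensional. Then g¹ is abelian, i.e., [[g,g],[g,g]] = 0; in particular g is 2-step solvable. -/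
/-- a finite-dimensional real Lie algebra whose derived algebra is
two-dimensional has abelian derived algebra; in particular it is 2-step solvable. -/
theorem stmt_6
    {L : Type*} [LieRing L] [LieAlgebra ℝ L] [FiniteDimensional ℝ L]
    (h2 : Module.finrank ℝ ↥(LieAlgebra.derivedSeries ℝ L 1) = 2) :
    (∀ x ∈ LieAlgebra.derivedSeries ℝ L 1, ∀ y ∈ LieAlgebra.derivedSeries ℝ L 1,
      ⁅x, y⁆ = 0) ∧
    LieAlgebra.derivedSeries ℝ L 2 = ⊥ := by
  have key : ∀ x ∈ LieAlgebra.derivedSeries ℝ L 1, ∀ y ∈ LieAlgebra.derivedSeries ℝ L 1,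
      ⁅x, y⁆ = 0 := by
    have htr : ∀ x ∈ LieAlgebra.derivedSeries ℝ L 1, LinearMap.trace ℝ _
        (LieModule.toEnd ℝ L ↥(LieAlgebra.derivedSeries ℝ L 1) x) = 0 := by
      intro x hx
      refine LieModule.trace_toEnd_eq_zero_of_mem_lcs ℝ L _ (k := 1) le_rfl ?_
      exact hx
    generalize LieAlgebra.derivedSeries ℝ L 1 = D at *
    let b : Module.Basis (Fin 2) ℝ D := Module.finBasisOfFinrankEq ℝ D h2
    have t0 := htr (b 0) (b 0).2
    have t1 := htr (b 1) (b 1).2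
    rw [LinearMap.trace_eq_matrix_trace ℝ b, Matrix.trace_fin_two, LinearMap.toMatrix_apply,
      LinearMap.toMatrix_apply] at t0 t1
    simp only [LieModule.toEnd_apply_apply] at t0 t1
    have z (u : D) : ⁅(u : L), u⁆ = 0 := by
      apply Subtype.ext; simp
    have sk : ⁅((b 1 : D) : L), b 0⁆ = -⁅((b 0 : D) : L), b 1⁆ := by
      apply Subtype.ext; simp
    rw [z] at t0 t1
    rw [sk] at t1
    simp at t0 t1
    have w0 : ⁅((b 0 : D) : L), b 1⁆ = 0 := by
      apply b.ext_elem
      intro i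
      fin_cases i
      · simpa using t1
      · simpa using t0
    have w1 : ⁅((b 0 : D) : L), ((b 1 : D) : L)⁆ = 0 := by
      simpa using congrArg Subtype.val w0
    have w2 : ⁅((b 1 : D) : L), ((b 0 : D) : L)⁆ = 0 := by
      rw [← lie_skew, w1, neg_zero]
    intro x hx y hy
    have ex := congrArg Subtype.val (b.sum_repr ⟨x, hx⟩)
    have ey := congrArg Subtype.val (b.sum_repr ⟨y, hy⟩)
    simp only [Fin.sum_univ_two] at ex ey
    rw [← show _ = x from ex, ← show _ = y from ey]
    simp [w1, w2]
  refine ⟨key, ?_⟩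
  change ⁅LieAlgebra.derivedSeries ℝ L 1, LieAlgebra.derivedSeries ℝ L 1⁆ = ⊥
  rw [LieSubmodule.lie_eq_bot_iff]
  exact key
end

section
/- The vectors a₂ and b₁ are linearly dependent; in particular, if a₂ ≠ 0 then b₁ is a scalar multiple of a₂. (This follows from the Jacobi identity applied to the triple (a₂, b₁, e₁), which yields ‖a₂‖²·‖b₁‖² = ⟨a₂,b₁⟩², together with the equality case of the Cauchy–Schwarz inequality.) -/
open scoped RealInnerProductSpace

/-- the vectors `a₂` and `b₁` are linearly dependent; in particular if
`a₂ ≠ 0` then `b₁` is a scalar multiple of `a₂`. -/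
theorem stmt_9
    {g : Type*} [NormedAddCommGroup g] [InnerProductSpace ℝ g] [FiniteDimensional ℝ g]
    (bra : g →ₗ[ℝ] g →ₗ[ℝ] g)
    (hbra_alt : ∀ x : g, bra x x = 0)
    (hbra_jac : ∀ x y z : g, bra (bra x y) z + bra (bra y z) x + bra (bra z x) y = 0)
    (e₁ e₂ : g) (he₁ : ‖e₁‖ = 1) (he₂ : ‖e₂‖ = 1) (he₁₂ : ⟪e₁, e₂⟫ = 0)
    (hder : Submodule.span ℝ {z : g | ∃ x y : g, z = bra x y} =
      Submodule.span ℝ ({e₁, e₂} : Set g))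
    (habel : bra e₁ e₂ = 0)
    (Γ : Submodule ℝ g) (hΓ : Γ = (Submodule.span ℝ ({e₁, e₂} : Set g))ᗮ)
    (a₁ a₂ b₁ b₂ : Γ)
    (hab : ∀ u : Γ,
      bra u e₁ = ⟪(a₁ : g), (u : g)⟫ • e₁ + ⟪(a₂ : g), (u : g)⟫ • e₂ ∧
      bra u e₂ = ⟪(b₁ : g), (u : g)⟫ • e₁ + ⟪(b₂ : g), (u : g)⟫ • e₂) :
    ¬ LinearIndependent ℝ ![a₂, b₁] ∧ (a₂ ≠ 0 → ∃ t : ℝ, b₁ = t • a₂) := by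
  have anti : ∀ x y : g, bra x y = - bra y x := by
    intro x y
    have h := hbra_alt (x + y)
    simp only [map_add, LinearMap.add_apply, hbra_alt, zero_add, add_zero] at h
    exact eq_neg_of_add_eq_zero_left (by rw [← h, add_comm])
  have h11 : ⟪e₁, e₁⟫ = 1 := by rw [real_inner_self_eq_norm_sq, he₁]; norm_num
  have hxy : bra (bra (a₂ : g) (b₁ : g)) e₁ = 0 := by
    have hm : bra (a₂ : g) (b₁ : g) ∈ Submodule.span ℝ ({e₁, e₂} : Set g) := by
      rw [← hder]
      exact Submodule.subset_span ⟨_, _, rfl⟩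
    obtain ⟨p, q, hpq⟩ := Submodule.mem_span_pair.1 hm
    rw [← hpq]
    simp [hbra_alt, anti e₂ e₁, habel]
  have hj := hbra_jac a₂ b₁ e₁
  rw [hxy, zero_add, anti (bra _ _) (a₂ : g), anti e₁ (a₂ : g), anti (-_) (b₁ : g)] at hj
  rw [(hab a₂).1, (hab b₁).1] at hj
  simp only [map_add, map_neg, map_smul, (hab a₂).1, (hab b₁).1, (hab a₂).2, (hab b₁).2] at hj
  have hk := congrArg (fun v => ⟪e₁, v⟫) hj
  simp only [inner_add_right, inner_neg_right, inner_smul_right, h11, he₁₂, inner_zero_right,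
    smul_add] at hk
  have key : ⟪(a₂ : g), (a₂ : g)⟫ * ⟪(b₁ : g), (b₁ : g)⟫ = ⟪(a₂ : g), (b₁ : g)⟫ ^ 2 := by
    rw [real_inner_comm (a₂ : g) (b₁ : g)] at hk
    rw [real_inner_comm (a₂ : g) (b₁ : g)] at *
    linarith
  have hdep : ⟪(a₂ : g), (a₂ : g)⟫ • b₁ = ⟪(a₂ : g), (b₁ : g)⟫ • a₂ := by
    apply Subtype.ext
    rw [← sub_eq_zero, ← inner_self_eq_zero (𝕜 := ℝ)]
    simp only [Submodule.coe_smul, inner_sub_left, inner_sub_right, real_inner_smul_left,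
      real_inner_smul_right, real_inner_comm (a₂ : g) (b₁ : g)]
    rw [real_inner_comm (a₂ : g) (b₁ : g)] at *
    linear_combination ⟪(a₂ : g), (a₂ : g)⟫ * key
  constructor
  · intro hli
    have h0 : a₂ ≠ 0 := hli.ne_zero 0
    have h := (LinearIndependent.pair_iff.1 hli) (-⟪(a₂ : g), (b₁ : g)⟫) ⟪(a₂ : g), (a₂ : g)⟫
      (by rw [hdep, neg_smul, neg_add_cancel])
    exact h0 (Subtype.ext (inner_self_eq_zero.1 h.2))
  · intro h0
    have hne : ⟪(a₂ : g), (a₂ : g)⟫ ≠ 0 := fun h => h0 (Subtype.ext (inner_self_eq_zero.1 h))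
    refine ⟨⟪(a₂ : g), (a₂ : g)⟫⁻¹ * ⟪(a₂ : g), (b₁ : g)⟫, ?_⟩
    rw [mul_smul, ← hdep, inv_smul_smul₀ hne]
end

section
/- For all u, v ∈ Γ one has tr(ad_u ∘ ad_v) = ⟨a₁,u⟩⟨a₁,v⟩ + ⟨b₁,u⟩⟨a₂,v⟩ + ⟨b₁,v⟩⟨a₂,u⟩ + ⟨b₂,u⟩⟨b₂,v⟩; moreover tr(ad_{e₁} ∘ ad_{e₁}) = tr(ad_{e₁} ∘ ad_{e₂}) = tr(ad_{e₂} ∘ ad_{e₂}) = 0 and tr(ad_{e₁} ∘ ad_u) = tr(ad_{e₂} ∘ ad_u) = 0 for all u ∈ Γ. -/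
open scoped RealInnerProductSpace

theorem trace_aux
    {g : Type*} [NormedAddCommGroup g] [InnerProductSpace ℝ g] [FiniteDimensional ℝ g]
    (e₁ e₂ : g) (he₁ : ‖e₁‖ = 1) (he₂ : ‖e₂‖ = 1) (he₁₂ : ⟪e₁, e₂⟫ = 0)
    (T : g →ₗ[ℝ] g) (hT : ∀ x, T x ∈ Submodule.span ℝ ({e₁, e₂} : Set g)) :
    LinearMap.trace ℝ g T = ⟪e₁, T e₁⟫ + ⟪e₂, T e₂⟫ := by
  have he₂₁ : ⟪e₂, e₁⟫ = 0 := by rw [real_inner_comm]; exact he₁₂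
  have h : T = ((innerₗ g e₁) ∘ₗ T).smulRight e₁ + ((innerₗ g e₂) ∘ₗ T).smulRight e₂ := by
    ext x
    obtain ⟨c, d, h⟩ := Submodule.mem_span_pair.1 (hT x)
    simp [← h, inner_add_right, inner_smul_right, he₁, he₂, he₁₂, he₂₁]
  conv_lhs => rw [h]
  rw [map_add, LinearMap.trace_smulRight, LinearMap.trace_smulRight]
  simp

/-- the traces `tr(ad_u ∘ ad_v)` for `u, v ∈ Γ`, and all traces
`tr(ad_x ∘ ad_y)` with `x` or `y` among `e₁, e₂`, are as stated. -/
theorem stmt_11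
    {g : Type*} [NormedAddCommGroup g] [InnerProductSpace ℝ g] [FiniteDimensional ℝ g]
    (bra : g →ₗ[ℝ] g →ₗ[ℝ] g)
    (hbra_alt : ∀ x : g, bra x x = 0)
    (hbra_jac : ∀ x y z : g, bra (bra x y) z + bra (bra y z) x + bra (bra z x) y = 0)
    (e₁ e₂ : g) (he₁ : ‖e₁‖ = 1) (he₂ : ‖e₂‖ = 1) (he₁₂ : ⟪e₁, e₂⟫ = 0)
    (hder : Submodule.span ℝ {z : g | ∃ x y : g, z = bra x y} =
      Submodule.span ℝ ({e₁, e₂} : Set g))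
    (habel : bra e₁ e₂ = 0)
    (Γ : Submodule ℝ g) (hΓ : Γ = (Submodule.span ℝ ({e₁, e₂} : Set g))ᗮ)
    (a₁ a₂ b₁ b₂ : Γ)
    (hab : ∀ u : Γ,
      bra u e₁ = ⟪(a₁ : g), (u : g)⟫ • e₁ + ⟪(a₂ : g), (u : g)⟫ • e₂ ∧
      bra u e₂ = ⟪(b₁ : g), (u : g)⟫ • e₁ + ⟪(b₂ : g), (u : g)⟫ • e₂) :
    (∀ u v : Γ, LinearMap.trace ℝ g (bra u ∘ₗ bra v) =
      ⟪(a₁ : g), (u : g)⟫ * ⟪(a₁ : g), (v : g)⟫ +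
      ⟪(b₁ : g), (u : g)⟫ * ⟪(a₂ : g), (v : g)⟫ +
      ⟪(b₁ : g), (v : g)⟫ * ⟪(a₂ : g), (u : g)⟫ +
      ⟪(b₂ : g), (u : g)⟫ * ⟪(b₂ : g), (v : g)⟫) ∧
    LinearMap.trace ℝ g (bra e₁ ∘ₗ bra e₁) = 0 ∧
    LinearMap.trace ℝ g (bra e₁ ∘ₗ bra e₂) = 0 ∧
    LinearMap.trace ℝ g (bra e₂ ∘ₗ bra e₂) = 0 ∧
    ∀ u : Γ, LinearMap.trace ℝ g (bra e₁ ∘ₗ bra u) = 0 ∧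
      LinearMap.trace ℝ g (bra e₂ ∘ₗ bra u) = 0 := by
  have he₂₁ : ⟪e₂, e₁⟫ = 0 := by rw [real_inner_comm]; exact he₁₂
  have hmem : ∀ x y, bra x y ∈ Submodule.span ℝ ({e₁, e₂} : Set g) := fun x y => by
    rw [← hder]; exact Submodule.subset_span ⟨x, y, rfl⟩
  have h21 : bra e₂ e₁ = 0 := by
    have h := hbra_alt (e₁ + e₂)
    simpa [hbra_alt, habel] using h
  have key : ∀ x y, LinearMap.trace ℝ g (bra x ∘ₗ bra y) =
      ⟪e₁, bra x (bra y e₁)⟫ + ⟪e₂, bra x (bra y e₂)⟫ := fun x y =>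
    trace_aux e₁ e₂ he₁ he₂ he₁₂ _ (fun z => hmem _ _)
  refine ⟨fun u v => ?_, ?_, ?_, ?_, fun u => ⟨?_, ?_⟩⟩
  · rw [key, (hab v).1, (hab v).2]
    simp only [map_add, map_smul, (hab u).1, (hab u).2, inner_add_right, inner_smul_right,
      he₁₂, he₂₁, real_inner_self_eq_norm_sq, he₁, he₂]
    ring
  · simp [key, hbra_alt, habel]
  · simp [key, hbra_alt, h21]
  · simp [key, hbra_alt, h21]
  · simp [key, (hab u).1, (hab u).2, hbra_alt, habel]
  · simp [key, (hab u).1, (hab u).2, hbra_alt, h21]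
end

section
/- One has tr(ad_{e₁} ∘ ad_{e₁}*) = ‖a₁‖² + ‖a₂‖², tr(ad_{e₂} ∘ ad_{e₂}*) = ‖b₁‖² + ‖b₂‖², and tr(ad_{e₁} ∘ ad_{e₂}*) = tr(ad_{e₂} ∘ ad_{e₁}*) = ⟨a₁,b₁⟩ + ⟨a₂,b₂⟩. -/
open scoped RealInnerProductSpace

theorem aux_trace {g : Type*} [NormedAddCommGroup g] [InnerProductSpace ℝ g]
    [FiniteDimensional ℝ g] (A B : g →ₗ[ℝ] g) (e₁ e₂ p q r s : g)
    (he₁ : ‖e₁‖ = 1) (he₂ : ‖e₂‖ = 1) (he₁₂ : ⟪e₁, e₂⟫ = 0)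
    (hA : ∀ x, A x = -(⟪p, x⟫ • e₁ + ⟪q, x⟫ • e₂))
    (hB : ∀ x, B x = -(⟪r, x⟫ • e₁ + ⟪s, x⟫ • e₂)) :
    LinearMap.trace ℝ g (A ∘ₗ LinearMap.adjoint B) = ⟪p, r⟫ + ⟪q, s⟫ := by
  have hBa : ∀ y, LinearMap.adjoint B y = -(⟪e₁, y⟫ • r + ⟪e₂, y⟫ • s) := by
    intro y
    refine ext_inner_right ℝ fun x => ?_
    rw [LinearMap.adjoint_inner_left, hB]
    simp only [inner_neg_left, inner_neg_right, inner_add_left, inner_add_right,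
      real_inner_smul_left, real_inner_smul_right]
    rw [real_inner_comm y e₁, real_inner_comm y e₂]
    ring
  have hAB : A ∘ₗ LinearMap.adjoint B =
      ((innerₛₗ ℝ e₁).smulRight (⟪p, r⟫ • e₁ + ⟪q, r⟫ • e₂) +
      (innerₛₗ ℝ e₂).smulRight (⟪p, s⟫ • e₁ + ⟪q, s⟫ • e₂) : g →ₗ[ℝ] g) := by
    ext y
    simp only [LinearMap.comp_apply, hBa, hA, LinearMap.add_apply, LinearMap.smulRight_apply,
      innerₛₗ_apply_apply, inner_neg_right, inner_add_right, real_inner_smul_right]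
    module
  have h21 : ⟪e₂, e₁⟫ = 0 := by rw [real_inner_comm]; exact he₁₂
  rw [hAB, map_add, LinearMap.trace_smulRight, LinearMap.trace_smulRight]
  simp [inner_add_right, real_inner_smul_right, he₁₂, h21, he₁, he₂]

/-- `tr(ad_{e₁} ∘ ad_{e₁}*) = ‖a₁‖² + ‖a₂‖²`,
`tr(ad_{e₂} ∘ ad_{e₂}*) = ‖b₁‖² + ‖b₂‖²`, and
`tr(ad_{e₁} ∘ ad_{e₂}*) = tr(ad_{e₂} ∘ ad_{e₁}*) = ⟨a₁,b₁⟩ + ⟨a₂,b₂⟩`. -/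
theorem stmt_12
    {g : Type*} [NormedAddCommGroup g] [InnerProductSpace ℝ g] [FiniteDimensional ℝ g]
    (bra : g →ₗ[ℝ] g →ₗ[ℝ] g)
    (hbra_alt : ∀ x : g, bra x x = 0)
    (hbra_jac : ∀ x y z : g, bra (bra x y) z + bra (bra y z) x + bra (bra z x) y = 0)
    (e₁ e₂ : g) (he₁ : ‖e₁‖ = 1) (he₂ : ‖e₂‖ = 1) (he₁₂ : ⟪e₁, e₂⟫ = 0)
    (hder : Submodule.span ℝ {z : g | ∃ x y : g, z = bra x y} =
      Submodule.span ℝ ({e₁, e₂} : Set g))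
    (habel : bra e₁ e₂ = 0)
    (Γ : Submodule ℝ g) (hΓ : Γ = (Submodule.span ℝ ({e₁, e₂} : Set g))ᗮ)
    (a₁ a₂ b₁ b₂ : Γ)
    (hab : ∀ u : Γ,
      bra u e₁ = ⟪(a₁ : g), (u : g)⟫ • e₁ + ⟪(a₂ : g), (u : g)⟫ • e₂ ∧
      bra u e₂ = ⟪(b₁ : g), (u : g)⟫ • e₁ + ⟪(b₂ : g), (u : g)⟫ • e₂) :
    LinearMap.trace ℝ g (bra e₁ ∘ₗ LinearMap.adjoint (bra e₁)) =
      ‖(a₁ : g)‖ ^ 2 + ‖(a₂ : g)‖ ^ 2 ∧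
    LinearMap.trace ℝ g (bra e₂ ∘ₗ LinearMap.adjoint (bra e₂)) =
      ‖(b₁ : g)‖ ^ 2 + ‖(b₂ : g)‖ ^ 2 ∧
    LinearMap.trace ℝ g (bra e₁ ∘ₗ LinearMap.adjoint (bra e₂)) =
      ⟪(a₁ : g), (b₁ : g)⟫ + ⟪(a₂ : g), (b₂ : g)⟫ ∧
    LinearMap.trace ℝ g (bra e₂ ∘ₗ LinearMap.adjoint (bra e₁)) =
      ⟪(a₁ : g), (b₁ : g)⟫ + ⟪(a₂ : g), (b₂ : g)⟫ := by
  have hskew : ∀ x y : g, bra x y = -bra y x := by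
    intro x y
    have h := hbra_alt (x + y)
    simp only [map_add, LinearMap.add_apply, hbra_alt, zero_add, add_zero] at h
    exact eq_neg_of_add_eq_zero_left (by rw [add_comm]; exact h)
  have h21 : ⟪e₂, e₁⟫ = 0 := by rw [real_inner_comm]; exact he₁₂
  have horth : ∀ a : Γ, ⟪(a : g), e₁⟫ = 0 ∧ ⟪(a : g), e₂⟫ = 0 := by
    intro a
    have h : (a : g) ∈ (Submodule.span ℝ ({e₁, e₂} : Set g))ᗮ := hΓ ▸ a.2
    rw [Submodule.mem_orthogonal'] at h
    exact ⟨h e₁ (Submodule.subset_span (by simp)), h e₂ (Submodule.subset_span (by simp))⟩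
  have hdec : ∀ x : g, ∃ u : Γ, x = (u : g) + (⟪e₁, x⟫ • e₁ + ⟪e₂, x⟫ • e₂) := by
    intro x
    refine ⟨⟨x - (⟪e₁, x⟫ • e₁ + ⟪e₂, x⟫ • e₂), ?_⟩, by simp⟩
    rw [hΓ, Submodule.mem_orthogonal]
    intro v hv
    obtain ⟨c, d, rfl⟩ := Submodule.mem_span_pair.1 hv
    simp only [inner_sub_right, inner_add_left, inner_add_right, real_inner_smul_left,
      real_inner_smul_right, he₁₂, h21, real_inner_self_eq_norm_sq, he₁, he₂]
    ring
  have hA : ∀ x, bra e₁ x = -(⟪(a₁ : g), x⟫ • e₁ + ⟪(a₂ : g), x⟫ • e₂) := by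
    intro x
    obtain ⟨u, hu⟩ := hdec x
    generalize ⟪e₁, x⟫ = c, ⟪e₂, x⟫ = d at hu
    subst hu
    simp only [map_add, map_smul, hbra_alt, habel, inner_add_right, real_inner_smul_right,
      (horth _).1, (horth _).2]
    rw [hskew e₁ u, (hab u).1]
    simp
  have hB : ∀ x, bra e₂ x = -(⟪(b₁ : g), x⟫ • e₁ + ⟪(b₂ : g), x⟫ • e₂) := by
    intro x
    obtain ⟨u, hu⟩ := hdec x
    generalize ⟪e₁, x⟫ = c, ⟪e₂, x⟫ = d at hu
    subst hu
    simp only [map_add, map_smul, hbra_alt, hskew e₂ e₁, habel, inner_add_right,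
      real_inner_smul_right, (horth _).1, (horth _).2]
    rw [hskew e₂ u, (hab u).2]
    simp
  refine ⟨?_, ?_, ?_, ?_⟩
  · rw [aux_trace _ _ e₁ e₂ _ _ _ _ he₁ he₂ he₁₂ hA hA, real_inner_self_eq_norm_sq,
      real_inner_self_eq_norm_sq]
  · rw [aux_trace _ _ e₁ e₂ _ _ _ _ he₁ he₂ he₁₂ hB hB, real_inner_self_eq_norm_sq,
      real_inner_self_eq_norm_sq]
  · exact aux_trace _ _ e₁ e₂ _ _ _ _ he₁ he₂ he₁₂ hA hB
  · rw [aux_trace _ _ e₁ e₂ _ _ _ _ he₁ he₂ he₁₂ hB hA, real_inner_comm (b₁ : g),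
      real_inner_comm (b₂ : g)]
end

section
/- For all u, v ∈ Γ one has tr(ad_u ∘ ad_v*) = ⟨a₁,u⟩⟨a₁,v⟩ + ⟨b₁,u⟩⟨b₁,v⟩ + ⟨a₂,u⟩⟨a₂,v⟩ + ⟨b₂,u⟩⟨b₂,v⟩ + ⟨f₁(u),f₁(v)⟩ + ⟨f₂(u),f₂(v)⟩. -/
open scoped RealInnerProductSpace

/-- for all `u, v ∈ Γ`, `tr(ad_u ∘ ad_v*)` equals
`⟨a₁,u⟩⟨a₁,v⟩ + ⟨b₁,u⟩⟨b₁,v⟩ + ⟨a₂,u⟩⟨a₂,v⟩ + ⟨b₂,u⟩⟨b₂,v⟩ + ⟨f₁u,f₁v⟩ + ⟨f₂u,f₂v⟩`. -/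
theorem stmt_13
    {g : Type*} [NormedAddCommGroup g] [InnerProductSpace ℝ g] [FiniteDimensional ℝ g]
    (bra : g →ₗ[ℝ] g →ₗ[ℝ] g)
    (hbra_alt : ∀ x : g, bra x x = 0)
    (hbra_jac : ∀ x y z : g, bra (bra x y) z + bra (bra y z) x + bra (bra z x) y = 0)
    (e₁ e₂ : g) (he₁ : ‖e₁‖ = 1) (he₂ : ‖e₂‖ = 1) (he₁₂ : ⟪e₁, e₂⟫ = 0)
    (hder : Submodule.span ℝ {z : g | ∃ x y : g, z = bra x y} =
      Submodule.span ℝ ({e₁, e₂} : Set g))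
    (habel : bra e₁ e₂ = 0)
    (Γ : Submodule ℝ g) (hΓ : Γ = (Submodule.span ℝ ({e₁, e₂} : Set g))ᗮ)
    (a₁ a₂ b₁ b₂ : Γ)
    (hab : ∀ u : Γ,
      bra u e₁ = ⟪(a₁ : g), (u : g)⟫ • e₁ + ⟪(a₂ : g), (u : g)⟫ • e₂ ∧
      bra u e₂ = ⟪(b₁ : g), (u : g)⟫ • e₁ + ⟪(b₂ : g), (u : g)⟫ • e₂)
    (f₁ f₂ : ↥Γ →ₗ[ℝ] ↥Γ)
    (hf₁_skew : ∀ u v : Γ, ⟪(f₁ u : g), (v : g)⟫ = -⟪(u : g), (f₁ v : g)⟫)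
    (hf₂_skew : ∀ u v : Γ, ⟪(f₂ u : g), (v : g)⟫ = -⟪(u : g), (f₂ v : g)⟫)
    (hf : ∀ u v : Γ,
      bra u v = ⟪(f₁ u : g), (v : g)⟫ • e₁ + ⟪(f₂ u : g), (v : g)⟫ • e₂) :
    ∀ u v : Γ, LinearMap.trace ℝ g (bra u ∘ₗ LinearMap.adjoint (bra v)) =
      ⟪(a₁ : g), (u : g)⟫ * ⟪(a₁ : g), (v : g)⟫ +
      ⟪(b₁ : g), (u : g)⟫ * ⟪(b₁ : g), (v : g)⟫ +
      ⟪(a₂ : g), (u : g)⟫ * ⟪(a₂ : g), (v : g)⟫ +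
      ⟪(b₂ : g), (u : g)⟫ * ⟪(b₂ : g), (v : g)⟫ +
      ⟪(f₁ u : g), (f₁ v : g)⟫ + ⟪(f₂ u : g), (f₂ v : g)⟫ := by
  have hG1 : ∀ w : Γ, ⟪e₁, (w : g)⟫ = 0 := by
    intro w
    have hw : (w : g) ∈ (Submodule.span ℝ ({e₁, e₂} : Set g))ᗮ := hΓ ▸ w.2
    exact (Submodule.mem_orthogonal _ _).1 hw e₁ (Submodule.subset_span (by simp))
  have hG2 : ∀ w : Γ, ⟪e₂, (w : g)⟫ = 0 := by
    intro w
    have hw : (w : g) ∈ (Submodule.span ℝ ({e₁, e₂} : Set g))ᗮ := hΓ ▸ w.2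
    exact (Submodule.mem_orthogonal _ _).1 hw e₂ (Submodule.subset_span (by simp))
  have hG1' : ∀ w : Γ, ⟪(w : g), e₁⟫ = 0 := fun w => by rw [real_inner_comm]; exact hG1 w
  have hG2' : ∀ w : Γ, ⟪(w : g), e₂⟫ = 0 := fun w => by rw [real_inner_comm]; exact hG2 w
  have h21 : ⟪e₂, e₁⟫ = 0 := by rw [real_inner_comm]; exact he₁₂
  have h11 : ⟪e₁, e₁⟫ = 1 := by rw [real_inner_self_eq_norm_sq, he₁]; norm_num
  have h22 : ⟪e₂, e₂⟫ = 1 := by rw [real_inner_self_eq_norm_sq, he₂]; norm_num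
  -- every vector decomposes along `e₁`, `e₂`, `Γ`
  have hdec : ∀ x : g, ∃ (s t : ℝ) (w : Γ), x = s • e₁ + t • e₂ + (w : g) := by
    intro x
    refine ⟨⟪e₁, x⟫, ⟪e₂, x⟫, ⟨x - (⟪e₁, x⟫ • e₁ + ⟪e₂, x⟫ • e₂), ?_⟩, ?_⟩
    · rw [hΓ, Submodule.mem_orthogonal]
      intro y hy
      obtain ⟨c, d, rfl⟩ := Submodule.mem_span_pair.1 hy
      simp only [inner_sub_right, inner_add_left, inner_add_right, real_inner_smul_left,
        real_inner_smul_right, h11, h22, he₁₂, h21]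
      ring
    · simp
  -- explicit form of `ad_u`
  have had : ∀ (u : Γ) (x : g), bra u x =
      ⟪⟪(a₁ : g), (u : g)⟫ • e₁ + ⟪(b₁ : g), (u : g)⟫ • e₂ + (f₁ u : g), x⟫ • e₁ +
      ⟪⟪(a₂ : g), (u : g)⟫ • e₁ + ⟪(b₂ : g), (u : g)⟫ • e₂ + (f₂ u : g), x⟫ • e₂ := by
    intro u x
    obtain ⟨s, t, w, rfl⟩ := hdec x
    rw [map_add, map_add, map_smul, map_smul, (hab u).1, (hab u).2, hf u w]
    simp only [inner_add_left, inner_add_right, real_inner_smul_left,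
      real_inner_smul_right, h11, h22, he₁₂, h21, hG1, hG2, hG1', hG2']
    module
  intro u v
  set p := ⟪(a₁ : g), (v : g)⟫ • e₁ + ⟪(b₁ : g), (v : g)⟫ • e₂ + (f₁ v : g) with hp
  set q := ⟪(a₂ : g), (v : g)⟫ • e₁ + ⟪(b₂ : g), (v : g)⟫ • e₂ + (f₂ v : g) with hq
  have hadj : ∀ y : g, LinearMap.adjoint (bra v) y = ⟪e₁, y⟫ • p + ⟪e₂, y⟫ • q := by
    intro y
    refine ext_inner_right ℝ fun x => ?_
    rw [LinearMap.adjoint_inner_left, had v x, ← hp, ← hq]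
    simp only [inner_add_left, inner_add_right, real_inner_smul_left, real_inner_smul_right,
      real_inner_comm y]
    ring
  have hcomp : bra u ∘ₗ LinearMap.adjoint (bra v) =
      ((InnerProductSpace.rankOne ℝ (bra u p) e₁ : g →L[ℝ] g) : g →ₗ[ℝ] g) +
      ((InnerProductSpace.rankOne ℝ (bra u q) e₂ : g →L[ℝ] g) : g →ₗ[ℝ] g) := by
    ext y
    simp [hadj y]
  rw [hcomp, map_add, InnerProductSpace.trace_rankOne, InnerProductSpace.trace_rankOne,
    had u p, had u q, hp, hq]
  simp only [inner_add_left, inner_add_right, real_inner_smul_left,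
    real_inner_smul_right, h11, h22, he₁₂, h21, hG1, hG2, hG1', hG2']
  ring
end

section
/- Define, for x ∈ g, the linear map J_x : g → g by J_x(y) = ad_y*(x). Then tr(J_{e₁} ∘ J_{e₁}) = -2(‖a₁‖² + ‖b₁‖²) + tr(f₁∘f₁), tr(J_{e₁} ∘ J_{e₂}) = tr(J_{e₂} ∘ J_{e₁}) = -2(⟨a₁,a₂⟩ + ⟨b₁,b₂⟩) + tr(f₁∘f₂), tr(J_{e₂} ∘ J_{e₂}) = -2(‖a₂‖² + ‖b₂‖²) + tr(f₂∘f₂), and tr(J_{e₁} ∘ J_u) = tr(J_{e₂} ∘ J_u) = tr(J_u ∘ J_v) = 0 for all u, v ∈ Γ. -/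
open scoped RealInnerProductSpace

lemma aux_decomp {g : Type*} [NormedAddCommGroup g] [InnerProductSpace ℝ g]
    (e₁ e₂ : g) (he₁ : ‖e₁‖ = 1) (he₂ : ‖e₂‖ = 1) (he₁₂ : ⟪e₁, e₂⟫ = 0) (x : g) :
    x - ⟪e₁, x⟫ • e₁ - ⟪e₂, x⟫ • e₂ ∈ (Submodule.span ℝ ({e₁, e₂} : Set g))ᗮ := by
  have h21 : ⟪e₂, e₁⟫ = 0 := by rw [real_inner_comm]; exact he₁₂
  rw [Submodule.mem_orthogonal]
  intro u hu
  obtain ⟨s, t, rfl⟩ := Submodule.mem_span_pair.1 hu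
  simp [inner_add_left, inner_sub_right, inner_smul_left, inner_smul_right, he₁₂, h21,
    he₁, he₂]
  ring

lemma aux_trace_s14 {g : Type*} [NormedAddCommGroup g] [InnerProductSpace ℝ g]
    [FiniteDimensional ℝ g]
    (e₁ e₂ : g) (he₁ : ‖e₁‖ = 1) (he₂ : ‖e₂‖ = 1) (he₁₂ : ⟪e₁, e₂⟫ = 0)
    (Γ : Submodule ℝ g) (hΓ : Γ = (Submodule.span ℝ ({e₁, e₂} : Set g))ᗮ)
    (T : g →ₗ[ℝ] g) (S : Γ →ₗ[ℝ] Γ) (hS : ∀ u v : Γ, ⟪T (u : g), (v : g)⟫ = ⟪(S u : g), (v : g)⟫) :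
    LinearMap.trace ℝ g T = ⟪e₁, T e₁⟫ + ⟪e₂, T e₂⟫ + LinearMap.trace ℝ Γ S := by
  have hmem := aux_decomp e₁ e₂ he₁ he₂ he₁₂
  rw [← hΓ] at hmem
  have o1 : ∀ u : Γ, ⟪e₁, (u : g)⟫ = 0 := by
    intro u
    have := hΓ.le u.2
    exact this e₁ (Submodule.subset_span (by simp))
  have o2 : ∀ u : Γ, ⟪e₂, (u : g)⟫ = 0 := by
    intro u
    have := hΓ.le u.2
    exact this e₂ (Submodule.subset_span (by simp))
  set P : g →ₗ[ℝ] Γ := LinearMap.adjoint Γ.subtype with hP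
  have hPS : P ∘ₗ (T ∘ₗ Γ.subtype) = S := by
    ext1 u
    refine ext_inner_right ℝ fun v => ?_
    simp only [hP, LinearMap.comp_apply, LinearMap.adjoint_inner_left]
    exact hS u v
  have hid : T = (T ∘ₗ Γ.subtype) ∘ₗ P + (innerₛₗ ℝ e₁).smulRight (T e₁)
      + (innerₛₗ ℝ e₂).smulRight (T e₂) := by
    ext x
    have hPx : P x = ⟨_, hmem x⟩ := by
      refine ext_inner_right ℝ fun v => ?_
      simp only [hP, LinearMap.adjoint_inner_left]
      simp [inner_sub_left, inner_smul_left, o1, o2]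
    simp [hPx]
    abel
  rw [← hPS, LinearMap.trace_comp_comm' (T ∘ₗ Γ.subtype) P]
  conv_lhs => rw [hid]
  simp only [map_add, LinearMap.trace_smulRight, innerₛₗ_apply_apply]
  ring

lemma aux_main {g : Type*} [NormedAddCommGroup g] [InnerProductSpace ℝ g]
    [FiniteDimensional ℝ g]
    (e₁ e₂ : g) (he₁ : ‖e₁‖ = 1) (he₂ : ‖e₂‖ = 1) (he₁₂ : ⟪e₁, e₂⟫ = 0)
    (Γ : Submodule ℝ g) (hΓ : Γ = (Submodule.span ℝ ({e₁, e₂} : Set g))ᗮ)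
    (a b c d : Γ) (f h : Γ →ₗ[ℝ] Γ) (J K : g →ₗ[ℝ] g)
    (J1 : J e₁ = -a) (J2 : J e₂ = -b) (K1 : K e₁ = -c) (K2 : K e₂ = -d)
    (JΓ : ∀ u : Γ, J u = ⟪(a : g), (u : g)⟫ • e₁ + ⟪(b : g), (u : g)⟫ • e₂ + f u)
    (KΓ : ∀ u : Γ, K u = ⟪(c : g), (u : g)⟫ • e₁ + ⟪(d : g), (u : g)⟫ • e₂ + h u) :
    LinearMap.trace ℝ g (J ∘ₗ K) =
      -2 * (⟪(a : g), (c : g)⟫ + ⟪(b : g), (d : g)⟫) + LinearMap.trace ℝ Γ (f ∘ₗ h) := by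
  have h21 : ⟪e₂, e₁⟫ = 0 := by rw [real_inner_comm]; exact he₁₂
  have o1 : ∀ u : Γ, ⟪e₁, (u : g)⟫ = 0 := by
    intro u
    have := hΓ.le u.2
    exact this e₁ (Submodule.subset_span (by simp))
  have o2 : ∀ u : Γ, ⟪e₂, (u : g)⟫ = 0 := by
    intro u
    have := hΓ.le u.2
    exact this e₂ (Submodule.subset_span (by simp))
  rw [aux_trace_s14 e₁ e₂ he₁ he₂ he₁₂ Γ hΓ (J ∘ₗ K)
    (f ∘ₗ h - (innerₛₗ ℝ c).smulRight a - (innerₛₗ ℝ d).smulRight b)]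
  · simp only [map_sub, LinearMap.trace_smulRight, innerₛₗ_apply_apply, LinearMap.comp_apply,
      K1, K2, map_neg, JΓ, inner_neg_right, inner_add_right, inner_smul_right, o1, o2, he₁₂, h21,
      real_inner_self_eq_norm_sq, he₁, he₂, Submodule.coe_inner]
    rw [real_inner_comm (c : g) (a : g), real_inner_comm (d : g) (b : g)]
    ring
  · intro u v
    simp only [LinearMap.comp_apply, KΓ, map_add, map_smul, J1, J2, JΓ, inner_add_left,
      inner_smul_left, o1, o2, LinearMap.sub_apply, LinearMap.smulRight_apply,
      innerₛₗ_apply_apply, Submodule.coe_inner, Submodule.coe_sub, Submodule.coe_smul,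
      inner_sub_left, inner_neg_left]
    simp
    ring



/-- with `J_x(y) := ad_y*(x)`, the traces `tr(J_x ∘ J_y)` are as stated. -/
theorem stmt_14
    {g : Type*} [NormedAddCommGroup g] [InnerProductSpace ℝ g] [FiniteDimensional ℝ g]
    (bra : g →ₗ[ℝ] g →ₗ[ℝ] g)
    (hbra_alt : ∀ x : g, bra x x = 0)
    (hbra_jac : ∀ x y z : g, bra (bra x y) z + bra (bra y z) x + bra (bra z x) y = 0)
    (e₁ e₂ : g) (he₁ : ‖e₁‖ = 1) (he₂ : ‖e₂‖ = 1) (he₁₂ : ⟪e₁, e₂⟫ = 0)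
    (hder : Submodule.span ℝ {z : g | ∃ x y : g, z = bra x y} =
      Submodule.span ℝ ({e₁, e₂} : Set g))
    (habel : bra e₁ e₂ = 0)
    (Γ : Submodule ℝ g) (hΓ : Γ = (Submodule.span ℝ ({e₁, e₂} : Set g))ᗮ)
    (a₁ a₂ b₁ b₂ : Γ)
    (hab : ∀ u : Γ,
      bra u e₁ = ⟪(a₁ : g), (u : g)⟫ • e₁ + ⟪(a₂ : g), (u : g)⟫ • e₂ ∧
      bra u e₂ = ⟪(b₁ : g), (u : g)⟫ • e₁ + ⟪(b₂ : g), (u : g)⟫ • e₂)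
    (f₁ f₂ : ↥Γ →ₗ[ℝ] ↥Γ)
    (hf₁_skew : ∀ u v : Γ, ⟪(f₁ u : g), (v : g)⟫ = -⟪(u : g), (f₁ v : g)⟫)
    (hf₂_skew : ∀ u v : Γ, ⟪(f₂ u : g), (v : g)⟫ = -⟪(u : g), (f₂ v : g)⟫)
    (hf : ∀ u v : Γ,
      bra u v = ⟪(f₁ u : g), (v : g)⟫ • e₁ + ⟪(f₂ u : g), (v : g)⟫ • e₂)
    (J : g → g →ₗ[ℝ] g)
    (hJ : ∀ x y : g, J x y = LinearMap.adjoint (bra y) x) :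
    LinearMap.trace ℝ g (J e₁ ∘ₗ J e₁) =
      -2 * (‖(a₁ : g)‖ ^ 2 + ‖(b₁ : g)‖ ^ 2) + LinearMap.trace ℝ ↥Γ (f₁ ∘ₗ f₁) ∧
    LinearMap.trace ℝ g (J e₁ ∘ₗ J e₂) =
      -2 * (⟪(a₁ : g), (a₂ : g)⟫ + ⟪(b₁ : g), (b₂ : g)⟫) +
        LinearMap.trace ℝ ↥Γ (f₁ ∘ₗ f₂) ∧
    LinearMap.trace ℝ g (J e₂ ∘ₗ J e₁) =
      -2 * (⟪(a₁ : g), (a₂ : g)⟫ + ⟪(b₁ : g), (b₂ : g)⟫) +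
        LinearMap.trace ℝ ↥Γ (f₁ ∘ₗ f₂) ∧
    LinearMap.trace ℝ g (J e₂ ∘ₗ J e₂) =
      -2 * (‖(a₂ : g)‖ ^ 2 + ‖(b₂ : g)‖ ^ 2) + LinearMap.trace ℝ ↥Γ (f₂ ∘ₗ f₂) ∧
    ∀ u v : Γ,
      LinearMap.trace ℝ g (J e₁ ∘ₗ J u) = 0 ∧
      LinearMap.trace ℝ g (J e₂ ∘ₗ J u) = 0 ∧
      LinearMap.trace ℝ g (J u ∘ₗ J v) = 0 := by
  have h21 : ⟪e₂, e₁⟫ = 0 := by rw [real_inner_comm]; exact he₁₂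
  have o1 : ∀ u : Γ, ⟪e₁, (u : g)⟫ = 0 := by
    intro u
    have := hΓ.le u.2
    exact this e₁ (Submodule.subset_span (by simp))
  have o2 : ∀ u : Γ, ⟪e₂, (u : g)⟫ = 0 := by
    intro u
    have := hΓ.le u.2
    exact this e₂ (Submodule.subset_span (by simp))
  have hmem := aux_decomp e₁ e₂ he₁ he₂ he₁₂
  rw [← hΓ] at hmem
  have hdec : ∀ x : g, ∃ (s t : ℝ) (w : Γ), x = s • e₁ + t • e₂ + w := fun x =>
    ⟨⟪e₁, x⟫, ⟪e₂, x⟫, ⟨_, hmem x⟩, by simp⟩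
  have hanti : ∀ x y, bra x y = - bra y x := by
    intro x y
    have := hbra_alt (x + y)
    simp only [map_add, LinearMap.add_apply, hbra_alt, zero_add, add_zero] at this
    exact eq_neg_of_add_eq_zero_left (by rw [add_comm]; exact this)
  have habel' : bra e₂ e₁ = 0 := by rw [hanti, habel, neg_zero]
  have o1' : ∀ u : Γ, ⟪(u : g), e₁⟫ = 0 := fun u => by rw [real_inner_comm]; exact o1 u
  have o2' : ∀ u : Γ, ⟪(u : g), e₂⟫ = 0 := fun u => by rw [real_inner_comm]; exact o2 u
  have key : ∀ x y z, ⟪J x y, z⟫ = ⟪x, bra y z⟫ := fun x y z => by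
    rw [hJ, LinearMap.adjoint_inner_left]
  have A : ∀ u : Γ, bra e₁ u = -(⟪(a₁ : g), (u : g)⟫ • e₁ + ⟪(a₂ : g), (u : g)⟫ • e₂) :=
    fun u => by rw [hanti, (hab u).1]
  have B : ∀ u : Γ, bra e₂ u = -(⟪(b₁ : g), (u : g)⟫ • e₁ + ⟪(b₂ : g), (u : g)⟫ • e₂) :=
    fun u => by rw [hanti, (hab u).2]
  have JZ : ∀ u : Γ, J u = 0 := by
    intro u
    ext y
    refine ext_inner_right ℝ fun z => ?_
    have hm : bra y z ∈ Submodule.span ℝ ({e₁, e₂} : Set g) := by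
      rw [← hder]; exact Submodule.subset_span ⟨y, z, rfl⟩
    obtain ⟨s, t, hst⟩ := Submodule.mem_span_pair.1 hm
    rw [key, ← hst]
    simp [inner_add_right, inner_smul_right, o1', o2']
  have J11 : J e₁ e₁ = -a₁ := by
    refine ext_inner_right ℝ fun z => ?_
    obtain ⟨s, t, w, rfl⟩ := hdec z
    rw [key]
    simp [hbra_alt, habel, A, inner_add_right, inner_smul_right, he₁₂, o1', o2', he₁]
  have J12 : J e₁ e₂ = -b₁ := by
    refine ext_inner_right ℝ fun z => ?_
    obtain ⟨s, t, w, rfl⟩ := hdec z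
    rw [key]
    simp [hbra_alt, habel', B, inner_add_right, inner_smul_right, he₁₂, o1', o2', he₁]
  have J21 : J e₂ e₁ = -a₂ := by
    refine ext_inner_right ℝ fun z => ?_
    obtain ⟨s, t, w, rfl⟩ := hdec z
    rw [key]
    simp [hbra_alt, habel, A, inner_add_right, inner_smul_right, h21, o1', o2', he₂]
  have J22 : J e₂ e₂ = -b₂ := by
    refine ext_inner_right ℝ fun z => ?_
    obtain ⟨s, t, w, rfl⟩ := hdec z
    rw [key]
    simp [hbra_alt, habel', B, inner_add_right, inner_smul_right, h21, o1', o2', he₂]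
  have J1Γ : ∀ u : Γ, J e₁ u = ⟪(a₁ : g), (u : g)⟫ • e₁ + ⟪(b₁ : g), (u : g)⟫ • e₂ + f₁ u := by
    intro u
    refine ext_inner_right ℝ fun z => ?_
    obtain ⟨s, t, w, rfl⟩ := hdec z
    rw [key]
    simp [(hab u).1, (hab u).2, hf, inner_add_right, inner_add_left, inner_smul_left,
      inner_smul_right, he₁₂, h21, o1', o2', o1, o2, he₁, he₂]
    try ring
  have J2Γ : ∀ u : Γ, J e₂ u = ⟪(a₂ : g), (u : g)⟫ • e₁ + ⟪(b₂ : g), (u : g)⟫ • e₂ + f₂ u := by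
    intro u
    refine ext_inner_right ℝ fun z => ?_
    obtain ⟨s, t, w, rfl⟩ := hdec z
    rw [key]
    simp [(hab u).1, (hab u).2, hf, inner_add_right, inner_add_left, inner_smul_left,
      inner_smul_right, he₁₂, h21, o1', o2', o1, o2, he₁, he₂]
    try ring
  have T12 := aux_main e₁ e₂ he₁ he₂ he₁₂ Γ hΓ a₁ b₁ a₂ b₂ f₁ f₂ (J e₁) (J e₂)
    J11 J12 J21 J22 J1Γ J2Γ
  refine ⟨?_, T12, ?_, ?_, fun u v => ?_⟩
  · rw [aux_main e₁ e₂ he₁ he₂ he₁₂ Γ hΓ a₁ b₁ a₁ b₁ f₁ f₁ (J e₁) (J e₁)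
      J11 J12 J11 J12 J1Γ J1Γ, real_inner_self_eq_norm_sq, real_inner_self_eq_norm_sq]
  · rw [LinearMap.trace_comp_comm', T12]
  · rw [aux_main e₁ e₂ he₁ he₂ he₁₂ Γ hΓ a₂ b₂ a₂ b₂ f₂ f₂ (J e₂) (J e₂)
      J21 J22 J21 J22 J2Γ J2Γ, real_inner_self_eq_norm_sq, real_inner_self_eq_norm_sq]
  · simp [JZ]
end

section
/- There exist a real number c and a derivation D of g such that Ric = c·id_g + D if and only if there exists a real number c such that for all u,v ∈ Γ the following eleven equations hold: (1) ⟨b₁,E₁⟩ - ⟨a₁,E₂⟩ = 0; (2) ⟨b₂,E₁⟩ - ⟨a₂,E₂⟩ = 0; (3) ⟨a₁,u⟩·E₁ + ⟨a₂,u⟩·E₂ = 0; (4) ⟨b₁,u⟩·E₁ + ⟨b₂,u⟩·E₂ = 0; (5) ⟨f₁(u),v⟩·E₁ + ⟨f₂(u),v⟩·E₂ = 0; (6) ⟨a₂ - b₁, u⟩·B₁ + ⟨f₁(E₁),u⟩ - ⟨a₁, E(u) - c·u⟩ = 0; (7) ⟨b₁ - a₂, u⟩·B₁ + ⟨f₂(E₂),u⟩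 - ⟨b₂, E(u) - c·u⟩ = 0; (8) (B₂ - A₁)·⟨a₂,u⟩ + B₁·⟨a₁ - b₂, u⟩ + ⟨f₂(E₁),u⟩ - ⟨a₂, E(u) - c·u⟩ = 0; (9) (B₂ - A₁)·⟨b₁,u⟩ + B₁·⟨a₁ - b₂, u⟩ - ⟨f₁(E₂),u⟩ + ⟨b₁, E(u) - c·u⟩ = 0; (10) ⟨f₁(u),v⟩·(A₁ - c) + ⟨f₂(u),v⟩·B₁ + ⟨a₁,v⟩·A(u) + ⟨b₁,v⟩·B(u) - ⟨f₁(E(u) - c·u), v⟩ - ⟨a₁,u⟩·A(v) - ⟨b₁,u⟩·B(v) + ⟨f₁(E(v) - c·v), u⟩ = 0; (11) ⟨f₂(u),v⟩·(B₂ - c) + ⟨f₁(u),v⟩·B₁ + ⟨a₂,v⟩·A(u) + ⟨b₂,v⟩·B(u) - ⟨f₂(E(u) - c·u), v⟩ - ⟨a₂,u⟩·A(v) - ⟨b₂,u⟩·B(v) + ⟨f₂(E(v) - c·v), u⟩ = 0. -/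
open scoped RealInnerProductSpace

/-- `(g, ⟨·,·⟩)` is an algebraic Ricci soliton iff there is a real
number `c` such that the eleven equations (1)–(11) hold for all `u, v ∈ Γ`. -/
theorem stmt_15
    {g : Type*} [NormedAddCommGroup g] [InnerProductSpace ℝ g] [FiniteDimensional ℝ g]
    (bra : g →ₗ[ℝ] g →ₗ[ℝ] g)
    (hbra_alt : ∀ x : g, bra x x = 0)
    (hbra_jac : ∀ x y z : g, bra (bra x y) z + bra (bra y z) x + bra (bra z x) y = 0)
    (e₁ e₂ : g) (he₁ : ‖e₁‖ = 1) (he₂ : ‖e₂‖ = 1) (he₁₂ : ⟪e₁, e₂⟫ = 0)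
    (hder : Submodule.span ℝ {z : g | ∃ x y : g, z = bra x y} =
      Submodule.span ℝ ({e₁, e₂} : Set g))
    (habel : bra e₁ e₂ = 0)
    (Γ : Submodule ℝ g) (hΓ : Γ = (Submodule.span ℝ ({e₁, e₂} : Set g))ᗮ)
    (a₁ a₂ b₁ b₂ : Γ)
    (hab : ∀ u : Γ,
      bra u e₁ = ⟪(a₁ : g), (u : g)⟫ • e₁ + ⟪(a₂ : g), (u : g)⟫ • e₂ ∧
      bra u e₂ = ⟪(b₁ : g), (u : g)⟫ • e₁ + ⟪(b₂ : g), (u : g)⟫ • e₂)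
    (f₁ f₂ : ↥Γ →ₗ[ℝ] ↥Γ)
    (hf₁_skew : ∀ u v : Γ, ⟪(f₁ u : g), (v : g)⟫ = -⟪(u : g), (f₁ v : g)⟫)
    (hf₂_skew : ∀ u v : Γ, ⟪(f₂ u : g), (v : g)⟫ = -⟪(u : g), (f₂ v : g)⟫)
    (hf : ∀ u v : Γ,
      bra u v = ⟪(f₁ u : g), (v : g)⟫ • e₁ + ⟪(f₂ u : g), (v : g)⟫ • e₂)
    (A₁ B₁ B₂ : ℝ)
    (hA₁ : A₁ = (1 / 2) * (‖(b₁ : g)‖ ^ 2 - ‖(a₂ : g)‖ ^ 2) -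
      (1 / 4) * LinearMap.trace ℝ ↥Γ (f₁ ∘ₗ f₁) - ‖(a₁ : g)‖ ^ 2 - ⟪(a₁ : g), (b₂ : g)⟫)
    (hB₁ : B₁ = -(⟪(a₁ : g), (b₁ : g)⟫ + ⟪(a₂ : g), (b₂ : g)⟫ +
      (1 / 4) * LinearMap.trace ℝ ↥Γ (f₁ ∘ₗ f₂)))
    (hB₂ : B₂ = (1 / 2) * (‖(a₂ : g)‖ ^ 2 - ‖(b₁ : g)‖ ^ 2) -
      (1 / 4) * LinearMap.trace ℝ ↥Γ (f₂ ∘ₗ f₂) - ‖(b₂ : g)‖ ^ 2 - ⟪(a₁ : g), (b₂ : g)⟫)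
    (E₁ E₂ : Γ)
    (hE₁ : E₁ = -f₁ (a₁ + (1 / 2 : ℝ) • b₂) - (1 / 2 : ℝ) • f₂ a₂)
    (hE₂ : E₂ = -f₂ (b₂ + (1 / 2 : ℝ) • a₁) - (1 / 2 : ℝ) • f₁ b₁)
    (A B : Γ → ℝ)
    (hA : ∀ u : Γ, A u = ⟪(E₁ : g), (u : g)⟫)
    (hB : ∀ u : Γ, B u = ⟪(E₂ : g), (u : g)⟫)
    (E : Γ → Γ)
    (hE : ∀ u : Γ, E u = -(⟪(u : g), (a₁ : g)⟫ • a₁) - ⟪(u : g), (b₂ : g)⟫ • b₂ -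
      ((1 / 2) * ⟪(u : g), (b₁ : g) + (a₂ : g)⟫) • (b₁ + a₂) +
      (1 / 2 : ℝ) • (f₁ (f₁ u) + f₂ (f₂ u)))
    (Ric : g →ₗ[ℝ] g)
    (hRic₁ : Ric e₁ = A₁ • e₁ + B₁ • e₂ + (E₁ : g))
    (hRic₂ : Ric e₂ = B₁ • e₁ + B₂ • e₂ + (E₂ : g))
    (hRicU : ∀ u : Γ, Ric u = A u • e₁ + B u • e₂ + (E u : g)) :
    (∃ (c : ℝ) (D : g →ₗ[ℝ] g),
        (∀ x y : g, D (bra x y) = bra (D x) y + bra x (D y)) ∧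
        Ric = c • (LinearMap.id : g →ₗ[ℝ] g) + D) ↔
      ∃ c : ℝ, ∀ u v : Γ,
        (⟪(b₁ : g), (E₁ : g)⟫ - ⟪(a₁ : g), (E₂ : g)⟫ = 0) ∧
        (⟪(b₂ : g), (E₁ : g)⟫ - ⟪(a₂ : g), (E₂ : g)⟫ = 0) ∧
        (⟪(a₁ : g), (u : g)⟫ • E₁ + ⟪(a₂ : g), (u : g)⟫ • E₂ = 0) ∧
        (⟪(b₁ : g), (u : g)⟫ • E₁ + ⟪(b₂ : g), (u : g)⟫ • E₂ = 0) ∧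
        (⟪(f₁ u : g), (v : g)⟫ • E₁ + ⟪(f₂ u : g), (v : g)⟫ • E₂ = 0) ∧
        (⟪((a₂ - b₁ : Γ) : g), (u : g)⟫ * B₁ + ⟪((f₁ E₁ : Γ) : g), (u : g)⟫ -
          ⟪(a₁ : g), ((E u - c • u : Γ) : g)⟫ = 0) ∧
        (⟪((b₁ - a₂ : Γ) : g), (u : g)⟫ * B₁ + ⟪((f₂ E₂ : Γ) : g), (u : g)⟫ -
          ⟪(b₂ : g), ((E u - c • u : Γ) : g)⟫ = 0) ∧
        ((B₂ - A₁) * ⟪(a₂ : g), (u : g)⟫ + B₁ * ⟪((a₁ - b₂ : Γ) : g), (u : g)⟫ +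
          ⟪((f₂ E₁ : Γ) : g), (u : g)⟫ - ⟪(a₂ : g), ((E u - c • u : Γ) : g)⟫ = 0) ∧
        ((B₂ - A₁) * ⟪(b₁ : g), (u : g)⟫ + B₁ * ⟪((a₁ - b₂ : Γ) : g), (u : g)⟫ -
          ⟪((f₁ E₂ : Γ) : g), (u : g)⟫ + ⟪(b₁ : g), ((E u - c • u : Γ) : g)⟫ = 0) ∧
        (⟪(f₁ u : g), (v : g)⟫ * (A₁ - c) + ⟪(f₂ u : g), (v : g)⟫ * B₁ +
          ⟪(a₁ : g), (v : g)⟫ * A u + ⟪(b₁ : g), (v : g)⟫ * B u -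
          ⟪((f₁ (E u - c • u) : Γ) : g), (v : g)⟫ -
          ⟪(a₁ : g), (u : g)⟫ * A v - ⟪(b₁ : g), (u : g)⟫ * B v +
          ⟪((f₁ (E v - c • v) : Γ) : g), (u : g)⟫ = 0) ∧
        (⟪(f₂ u : g), (v : g)⟫ * (B₂ - c) + ⟪(f₁ u : g), (v : g)⟫ * B₁ +
          ⟪(a₂ : g), (v : g)⟫ * A u + ⟪(b₂ : g), (v : g)⟫ * B u -
          ⟪((f₂ (E u - c • u) : Γ) : g), (v : g)⟫ -
          ⟪(a₂ : g), (u : g)⟫ * A v - ⟪(b₂ : g), (u : g)⟫ * B v +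
          ⟪((f₂ (E v - c • v) : Γ) : g), (u : g)⟫ = 0) := by
  have hskew : ∀ x y : g, bra x y = - bra y x := by
    intro x y
    have h := hbra_alt (x + y)
    simp only [map_add, LinearMap.add_apply, hbra_alt, zero_add, add_zero] at h
    exact eq_neg_of_add_eq_zero_right h
  have hΓ₁ : ∀ w : Γ, ⟪e₁, (w : g)⟫ = 0 := by
    intro w
    have hw : (w : g) ∈ (Submodule.span ℝ ({e₁, e₂} : Set g))ᗮ := hΓ ▸ w.2
    exact hw e₁ (Submodule.subset_span (by simp))
  have hΓ₂ : ∀ w : Γ, ⟪e₂, (w : g)⟫ = 0 := by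
    intro w
    have hw : (w : g) ∈ (Submodule.span ℝ ({e₁, e₂} : Set g))ᗮ := hΓ ▸ w.2
    exact hw e₂ (Submodule.subset_span (by simp))
  have n₁ : ⟪e₁, e₁⟫ = (1 : ℝ) := by rw [real_inner_self_eq_norm_sq, he₁]; norm_num
  have n₂ : ⟪e₂, e₂⟫ = (1 : ℝ) := by rw [real_inner_self_eq_norm_sq, he₂]; norm_num
  have he₂₁ : ⟪e₂, e₁⟫ = (0 : ℝ) := by rw [real_inner_comm, he₁₂]
  -- uniqueness of components
  have key : ∀ (p q : ℝ) (w : Γ), p • e₁ + q • e₂ + (w : g) = 0 ↔ p = 0 ∧ q = 0 ∧ w = 0 := by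
    intro p q w
    constructor
    · intro h
      have h1 := congrArg (fun z => ⟪e₁, z⟫) h
      have h2 := congrArg (fun z => ⟪e₂, z⟫) h
      simp only [inner_add_right, inner_smul_right, n₁, n₂, he₁₂, he₂₁, hΓ₁, hΓ₂, mul_one,
        mul_zero, add_zero, zero_add, inner_zero_right] at h1 h2
      refine ⟨h1, h2, ?_⟩
      subst h1 h2
      simpa using h
    · rintro ⟨rfl, rfl, rfl⟩
      simp
  -- decomposition
  have hdec : ∀ x : g, ∃ (p q : ℝ) (w : Γ), x = p • e₁ + q • e₂ + (w : g) := by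
    intro x
    have hm : x - ⟪e₁, x⟫ • e₁ - ⟪e₂, x⟫ • e₂ ∈ Γ := by
      rw [hΓ, Submodule.mem_orthogonal]
      intro z hz
      obtain ⟨r, s, rfl⟩ := Submodule.mem_span_pair.1 hz
      simp only [inner_add_left, inner_sub_right, inner_smul_left, inner_smul_right, n₁, n₂,
        he₁₂, he₂₁]
      simp
      ring
    exact ⟨⟪e₁, x⟫, ⟪e₂, x⟫, ⟨_, hm⟩, by simp only []; abel⟩
  -- brackets
  have hb₁ : ∀ u : Γ, bra (u : g) e₁ = ⟪(a₁ : g), (u : g)⟫ • e₁ + ⟪(a₂ : g), (u : g)⟫ • e₂ :=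
    fun u => (hab u).1
  have hb₂ : ∀ u : Γ, bra (u : g) e₂ = ⟪(b₁ : g), (u : g)⟫ • e₁ + ⟪(b₂ : g), (u : g)⟫ • e₂ :=
    fun u => (hab u).2
  have hb₁' : ∀ u : Γ, bra e₁ (u : g) =
      -(⟪(a₁ : g), (u : g)⟫ • e₁ + ⟪(a₂ : g), (u : g)⟫ • e₂) :=
    fun u => by rw [hskew, hb₁]
  have hb₂' : ∀ u : Γ, bra e₂ (u : g) =
      -(⟪(b₁ : g), (u : g)⟫ • e₁ + ⟪(b₂ : g), (u : g)⟫ • e₂) :=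
    fun u => by rw [hskew, hb₂]
  have habel' : bra e₂ e₁ = 0 := by rw [hskew, habel, neg_zero]
  have s₁ : ∀ u v : Γ, ⟪(f₁ u : g), (v : g)⟫ = -⟪(f₁ v : g), (u : g)⟫ := fun u v => by
    rw [hf₁_skew, real_inner_comm]
  have s₂ : ∀ u v : Γ, ⟪(f₂ u : g), (v : g)⟫ = -⟪(f₂ v : g), (u : g)⟫ := fun u v => by
    rw [hf₂_skew, real_inner_comm]
  -- reformulate the left-hand side
  have hL : (∃ (c : ℝ) (D : g →ₗ[ℝ] g),
        (∀ x y : g, D (bra x y) = bra (D x) y + bra x (D y)) ∧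
        Ric = c • (LinearMap.id : g →ₗ[ℝ] g) + D) ↔
      ∃ c : ℝ, ∀ x y : g, (Ric - c • (LinearMap.id : g →ₗ[ℝ] g)) (bra x y) =
        bra ((Ric - c • (LinearMap.id : g →ₗ[ℝ] g)) x) y + bra x ((Ric - c • (LinearMap.id : g →ₗ[ℝ] g)) y) := by
    constructor
    · rintro ⟨c, D, h, hR⟩
      have : Ric - c • LinearMap.id = D := by rw [hR]; abel
      exact ⟨c, by rw [this]; exact h⟩
    · rintro ⟨c, h⟩
      exact ⟨c, _, h, by abel⟩
  rw [hL]
  refine exists_congr fun c => ?_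
  generalize hD : Ric - c • (LinearMap.id : g →ₗ[ℝ] g) = D
  have D₁ : D e₁ = (A₁ - c) • e₁ + B₁ • e₂ + (E₁ : g) := by
    rw [← hD]; simp only [LinearMap.sub_apply, LinearMap.smul_apply, LinearMap.id_apply, hRic₁]
    module
  have D₂ : D e₂ = B₁ • e₁ + (B₂ - c) • e₂ + (E₂ : g) := by
    rw [← hD]; simp only [LinearMap.sub_apply, LinearMap.smul_apply, LinearMap.id_apply, hRic₂]
    module
  have DU : ∀ u : Γ, D u = A u • e₁ + B u • e₂ + ((E u - c • u : Γ) : g) := by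
    intro u
    rw [← hD]; simp only [LinearMap.sub_apply, LinearMap.smul_apply, LinearMap.id_apply, hRicU,
      Submodule.coe_sub, Submodule.coe_smul]
    module
  clear hA₁ hB₁ hB₂ hE₁ hE₂ hE hRic₁ hRic₂ hRicU hL hder
  have P12 : D (bra e₁ e₂) = bra (D e₁) e₂ + bra e₁ (D e₂) ↔
      (⟪(b₁ : g), (E₁ : g)⟫ - ⟪(a₁ : g), (E₂ : g)⟫ = 0) ∧
      (⟪(b₂ : g), (E₁ : g)⟫ - ⟪(a₂ : g), (E₂ : g)⟫ = 0) := by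
    have h := key (⟪(b₁ : g), (E₁ : g)⟫ - ⟪(a₁ : g), (E₂ : g)⟫)
      (⟪(b₂ : g), (E₁ : g)⟫ - ⟪(a₂ : g), (E₂ : g)⟫) 0
    simp only [and_true] at h
    rw [← h, eq_comm, ← sub_eq_zero]
    apply Eq.congr_left
    rw [D₁, D₂]
    simp only [map_add, map_smul, LinearMap.add_apply, LinearMap.smul_apply, hbra_alt, habel,
      hb₂, hb₁', map_zero, Submodule.coe_zero]
    module
  have PU1 : ∀ u : Γ, D (bra u e₁) = bra (D u) e₁ + bra u (D e₁) ↔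
      (⟪((a₂ - b₁ : Γ) : g), (u : g)⟫ * B₁ + ⟪((f₁ E₁ : Γ) : g), (u : g)⟫ -
          ⟪(a₁ : g), ((E u - c • u : Γ) : g)⟫ = 0) ∧
      ((B₂ - A₁) * ⟪(a₂ : g), (u : g)⟫ + B₁ * ⟪((a₁ - b₂ : Γ) : g), (u : g)⟫ +
          ⟪((f₂ E₁ : Γ) : g), (u : g)⟫ - ⟪(a₂ : g), ((E u - c • u : Γ) : g)⟫ = 0) ∧
      (⟪(a₁ : g), (u : g)⟫ • E₁ + ⟪(a₂ : g), (u : g)⟫ • E₂ = 0) := by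
    intro u
    rw [← key, ← sub_eq_zero]
    apply Eq.congr_left
    rw [hb₁, map_add, map_smul, map_smul, D₁, D₂, DU, s₁ E₁, s₂ E₁]
    generalize E u - c • u = F
    simp only [map_add, map_smul, LinearMap.add_apply, LinearMap.smul_apply, hbra_alt, habel',
      hb₁, hb₂, hf, Submodule.coe_sub, Submodule.coe_add, Submodule.coe_smul, inner_sub_left]
    module
  have PU2 : ∀ u : Γ, D (bra u e₂) = bra (D u) e₂ + bra u (D e₂) ↔
      ((B₂ - A₁) * ⟪(b₁ : g), (u : g)⟫ + B₁ * ⟪((a₁ - b₂ : Γ) : g), (u : g)⟫ -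
          ⟪((f₁ E₂ : Γ) : g), (u : g)⟫ + ⟪(b₁ : g), ((E u - c • u : Γ) : g)⟫ = 0) ∧
      (⟪((b₁ - a₂ : Γ) : g), (u : g)⟫ * B₁ + ⟪((f₂ E₂ : Γ) : g), (u : g)⟫ -
          ⟪(b₂ : g), ((E u - c • u : Γ) : g)⟫ = 0) ∧
      (⟪(b₁ : g), (u : g)⟫ • E₁ + ⟪(b₂ : g), (u : g)⟫ • E₂ = 0) := by
    intro u
    rw [← neg_eq_zero (a := (B₂ - A₁) * ⟪(b₁ : g), (u : g)⟫ + _ - _ + _), ← key, ← sub_eq_zero]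
    apply Eq.congr_left
    rw [hb₂, map_add, map_smul, map_smul, D₁, D₂, DU, s₁ E₂, s₂ E₂]
    generalize E u - c • u = F
    simp only [map_add, map_smul, LinearMap.add_apply, LinearMap.smul_apply, hbra_alt, habel,
      hb₁, hb₂, hf, Submodule.coe_sub, Submodule.coe_add, Submodule.coe_smul, inner_sub_left]
    module
  have PUV : ∀ u v : Γ, D (bra u v) = bra (D u) v + bra u (D v) ↔
      (⟪(f₁ u : g), (v : g)⟫ * (A₁ - c) + ⟪(f₂ u : g), (v : g)⟫ * B₁ +
          ⟪(a₁ : g), (v : g)⟫ * A u + ⟪(b₁ : g), (v : g)⟫ * B u -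
          ⟪((f₁ (E u - c • u) : Γ) : g), (v : g)⟫ -
          ⟪(a₁ : g), (u : g)⟫ * A v - ⟪(b₁ : g), (u : g)⟫ * B v +
          ⟪((f₁ (E v - c • v) : Γ) : g), (u : g)⟫ = 0) ∧
      (⟪(f₂ u : g), (v : g)⟫ * (B₂ - c) + ⟪(f₁ u : g), (v : g)⟫ * B₁ +
          ⟪(a₂ : g), (v : g)⟫ * A u + ⟪(b₂ : g), (v : g)⟫ * B u -
          ⟪((f₂ (E u - c • u) : Γ) : g), (v : g)⟫ -
          ⟪(a₂ : g), (u : g)⟫ * A v - ⟪(b₂ : g), (u : g)⟫ * B v +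
          ⟪((f₂ (E v - c • v) : Γ) : g), (u : g)⟫ = 0) ∧
      (⟪(f₁ u : g), (v : g)⟫ • E₁ + ⟪(f₂ u : g), (v : g)⟫ • E₂ = 0) := by
    intro u v
    rw [← key, ← sub_eq_zero]
    apply Eq.congr_left
    rw [hf, map_add, map_smul, map_smul, D₁, D₂, DU, DU, s₁ (E v - c • v), s₂ (E v - c • v)]
    generalize E u - c • u = F
    generalize E v - c • v = G
    simp only [map_add, map_smul, LinearMap.add_apply, LinearMap.smul_apply,
      hb₁, hb₂, hb₁', hb₂', hf, Submodule.coe_add, Submodule.coe_smul]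
    module
  constructor
  · intro h u v
    obtain ⟨h1, h2⟩ := P12.1 (h _ _)
    obtain ⟨h6, h8, h3⟩ := (PU1 u).1 (h _ _)
    obtain ⟨h9, h7, h4⟩ := (PU2 u).1 (h _ _)
    obtain ⟨h10, h11, h5⟩ := (PUV u v).1 (h _ _)
    exact ⟨h1, h2, h3, h4, h5, h6, h7, h8, h9, h10, h11⟩
  · intro h
    have q12 : D (bra e₁ e₂) = bra (D e₁) e₂ + bra e₁ (D e₂) := by
      obtain ⟨h1, h2, -⟩ := h 0 0
      exact P12.2 ⟨h1, h2⟩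
    have qu1 : ∀ u : Γ, D (bra u e₁) = bra (D u) e₁ + bra u (D e₁) := by
      intro u
      obtain ⟨h1, h2, h3, h4, h5, h6, h7, h8, h9, h10, h11⟩ := h u 0
      exact (PU1 u).2 ⟨h6, h8, h3⟩
    have qu2 : ∀ u : Γ, D (bra u e₂) = bra (D u) e₂ + bra u (D e₂) := by
      intro u
      obtain ⟨h1, h2, h3, h4, h5, h6, h7, h8, h9, h10, h11⟩ := h u 0
      exact (PU2 u).2 ⟨h9, h7, h4⟩
    have quv : ∀ u v : Γ, D (bra u v) = bra (D u) v + bra u (D v) := by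
      intro u v
      obtain ⟨h1, h2, h3, h4, h5, h6, h7, h8, h9, h10, h11⟩ := h u v
      exact (PUV u v).2 ⟨h10, h11, h5⟩
    have symm' : ∀ x y : g, D (bra x y) = bra (D x) y + bra x (D y) →
        D (bra y x) = bra (D y) x + bra y (D x) := by
      intro x y hxy
      rw [hskew y x, map_neg, hxy, hskew (D y) x, hskew y (D x)]
      abel
    have qs : ∀ x : g, D (bra x x) = bra (D x) x + bra x (D x) := by
      intro x
      rw [hbra_alt, map_zero, hskew (D x) x]
      abel
    have comb : ∀ x : g, D (bra x e₁) = bra (D x) e₁ + bra x (D e₁) →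
        D (bra x e₂) = bra (D x) e₂ + bra x (D e₂) →
        (∀ u : Γ, D (bra x u) = bra (D x) u + bra x (D u)) →
        ∀ y : g, D (bra x y) = bra (D x) y + bra x (D y) := by
      intro x k1 k2 k3 y
      obtain ⟨p, q, w, rfl⟩ := hdec y
      simp only [map_add, map_smul, k1, k2, k3 w]
      module
    have r1 := comb e₁ (qs _) q12 (fun u => symm' _ _ (qu1 u))
    have r2 := comb e₂ (symm' _ _ q12) (qs _) (fun u => symm' _ _ (qu2 u))
    have r3 : ∀ u : Γ, ∀ y : g, D (bra u y) = bra (D u) y + bra u (D y) :=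
      fun u => comb u (qu1 u) (qu2 u) (quv u)
    intro x
    exact comb x (symm' _ _ (r1 x)) (symm' _ _ (r2 x)) (fun u => symm' _ _ (r3 u x))
end

section
/- Assume a₁ = a₂ = b₁ = b₂ = 0 (i.e., g is 2-step nilpotent with g¹ contained in its center), and write F := f₁∘f₁ + f₂∘f₂. Then for a real number c, the linear map D := Ric - c·id_g is a derivation of g (equivalently, (g,⟨·,·⟩) is an algebraic Ricci soliton with constant c) if and only if for all u ∈ Γ: c·f₁(u) = ¼tr(f₁∘f₁)·f₁(u) + ¼tr(f₁∘f₂)·f₂(u) + ½·f₁(F(u)) + ½·F(f₁(u)) and c·f₂(u) = ¼tr(f₂∘f₂)·f₂(u) + ¼tr(f₁∘f₂)·f₁(u) + ½·f₂(F(u)) + ½·F(f₂(u)). -/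
open scoped RealInnerProductSpace

/-- the 2-step nilpotent case `a₁ = a₂ = b₁ = b₂ = 0`. With
`F := f₁∘f₁ + f₂∘f₂`, the map `D := Ric - c·id` is a derivation iff the two stated
equations hold for all `u ∈ Γ`. -/
theorem stmt_16
    {g : Type*} [NormedAddCommGroup g] [InnerProductSpace ℝ g] [FiniteDimensional ℝ g]
    (bra : g →ₗ[ℝ] g →ₗ[ℝ] g)
    (hbra_alt : ∀ x : g, bra x x = 0)
    (hbra_jac : ∀ x y z : g, bra (bra x y) z + bra (bra y z) x + bra (bra z x) y = 0)
    (e₁ e₂ : g) (he₁ : ‖e₁‖ = 1) (he₂ : ‖e₂‖ = 1) (he₁₂ : ⟪e₁, e₂⟫ = 0)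
    (hder : Submodule.span ℝ {z : g | ∃ x y : g, z = bra x y} =
      Submodule.span ℝ ({e₁, e₂} : Set g))
    (habel : bra e₁ e₂ = 0)
    (Γ : Submodule ℝ g) (hΓ : Γ = (Submodule.span ℝ ({e₁, e₂} : Set g))ᗮ)
    (a₁ a₂ b₁ b₂ : Γ)
    (hab : ∀ u : Γ,
      bra u e₁ = ⟪(a₁ : g), (u : g)⟫ • e₁ + ⟪(a₂ : g), (u : g)⟫ • e₂ ∧
      bra u e₂ = ⟪(b₁ : g), (u : g)⟫ • e₁ + ⟪(b₂ : g), (u : g)⟫ • e₂)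
    (f₁ f₂ : ↥Γ →ₗ[ℝ] ↥Γ)
    (hf₁_skew : ∀ u v : Γ, ⟪(f₁ u : g), (v : g)⟫ = -⟪(u : g), (f₁ v : g)⟫)
    (hf₂_skew : ∀ u v : Γ, ⟪(f₂ u : g), (v : g)⟫ = -⟪(u : g), (f₂ v : g)⟫)
    (hf : ∀ u v : Γ,
      bra u v = ⟪(f₁ u : g), (v : g)⟫ • e₁ + ⟪(f₂ u : g), (v : g)⟫ • e₂)
    (ha₁ : a₁ = 0) (ha₂ : a₂ = 0) (hb₁ : b₁ = 0) (hb₂ : b₂ = 0)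
    (F : ↥Γ →ₗ[ℝ] ↥Γ) (hF : F = f₁ ∘ₗ f₁ + f₂ ∘ₗ f₂)
    (Ric : g →ₗ[ℝ] g)
    (hRic₁ : Ric e₁ = (-(1 / 4) * LinearMap.trace ℝ ↥Γ (f₁ ∘ₗ f₁)) • e₁ +
      (-(1 / 4) * LinearMap.trace ℝ ↥Γ (f₁ ∘ₗ f₂)) • e₂)
    (hRic₂ : Ric e₂ = (-(1 / 4) * LinearMap.trace ℝ ↥Γ (f₁ ∘ₗ f₂)) • e₁ +
      (-(1 / 4) * LinearMap.trace ℝ ↥Γ (f₂ ∘ₗ f₂)) • e₂)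
    (hRicU : ∀ u : Γ, Ric u = (1 / 2 : ℝ) • ((F u : Γ) : g))
    (c : ℝ) :
    (∀ x y : g,
        (Ric - c • (LinearMap.id : g →ₗ[ℝ] g)) (bra x y) =
          bra ((Ric - c • (LinearMap.id : g →ₗ[ℝ] g)) x) y +
          bra x ((Ric - c • (LinearMap.id : g →ₗ[ℝ] g)) y)) ↔
      ∀ u : Γ,
        c • f₁ u = ((1 / 4) * LinearMap.trace ℝ ↥Γ (f₁ ∘ₗ f₁)) • f₁ u +
          ((1 / 4) * LinearMap.trace ℝ ↥Γ (f₁ ∘ₗ f₂)) • f₂ u +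
          (1 / 2 : ℝ) • f₁ (F u) + (1 / 2 : ℝ) • F (f₁ u) ∧
        c • f₂ u = ((1 / 4) * LinearMap.trace ℝ ↥Γ (f₂ ∘ₗ f₂)) • f₂ u +
          ((1 / 4) * LinearMap.trace ℝ ↥Γ (f₁ ∘ₗ f₂)) • f₁ u +
          (1 / 2 : ℝ) • f₂ (F u) + (1 / 2 : ℝ) • F (f₂ u) := by
  subst ha₁ ha₂ hb₁ hb₂
  have hue₁ : ∀ u : Γ, bra u e₁ = 0 := fun u => by simpa using (hab u).1
  have hue₂ : ∀ u : Γ, bra u e₂ = 0 := fun u => by simpa using (hab u).2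
  have hskew : ∀ x y : g, bra x y = - bra y x := by
    intro x y
    have h := hbra_alt (x + y)
    simp only [map_add, LinearMap.add_apply, hbra_alt, zero_add, add_zero] at h
    exact eq_neg_of_add_eq_zero_right h
  have hdec : ∀ x : g, ∃ (p q : ℝ) (u : Γ), x = p • e₁ + q • e₂ + (u : g) := by
    intro x
    obtain ⟨y, hy, z, hz, rfl⟩ :=
      (Submodule.span ℝ ({e₁, e₂} : Set g)).exists_add_mem_mem_orthogonal x
    obtain ⟨p, q, rfl⟩ := Submodule.mem_span_pair.1 hy
    exact ⟨p, q, ⟨z, hΓ ▸ hz⟩, rfl⟩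
  have hxe₁ : ∀ x : g, bra x e₁ = 0 := by
    intro x
    obtain ⟨p, q, u, rfl⟩ := hdec x
    simp [hbra_alt, hue₁, hskew e₂ e₁, habel]
  have hxe₂ : ∀ x : g, bra x e₂ = 0 := by
    intro x
    obtain ⟨p, q, u, rfl⟩ := hdec x
    simp [hbra_alt, hue₂, habel]
  have hex₁ : ∀ x : g, bra e₁ x = 0 := fun x => by rw [hskew, hxe₁, neg_zero]
  have hex₂ : ∀ x : g, bra e₂ x = 0 := fun x => by rw [hskew, hxe₂, neg_zero]
  have hFsym : ∀ u v : Γ, ⟪(u : g), (F v : g)⟫ = ⟪(F u : g), (v : g)⟫ := by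
    intro u v
    subst hF
    simp only [LinearMap.add_apply, LinearMap.comp_apply, Submodule.coe_add,
      inner_add_left, inner_add_right, hf₁_skew, hf₂_skew, neg_neg]
  set t₁ := LinearMap.trace ℝ ↥Γ (f₁ ∘ₗ f₁)
  set t₂ := LinearMap.trace ℝ ↥Γ (f₁ ∘ₗ f₂)
  set t₃ := LinearMap.trace ℝ ↥Γ (f₂ ∘ₗ f₂)
  set D : g →ₗ[ℝ] g := Ric - c • (LinearMap.id : g →ₗ[ℝ] g) with hD
  have hDe₁ : D e₁ = (-(1 / 4) * t₁ - c) • e₁ + (-(1 / 4) * t₂) • e₂ := by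
    simp only [hD, LinearMap.sub_apply, LinearMap.smul_apply, LinearMap.id_apply, hRic₁]
    module
  have hDe₂ : D e₂ = (-(1 / 4) * t₂) • e₁ + (-(1 / 4) * t₃ - c) • e₂ := by
    simp only [hD, LinearMap.sub_apply, LinearMap.smul_apply, LinearMap.id_apply, hRic₂]
    module
  have hDu : ∀ u : Γ, D u = (((1 / 2 : ℝ) • F u - c • u : Γ) : g) := by
    intro u
    simp [hD, hRicU]
  let E₁ : Γ → Γ := fun u => (1 / 4 * t₁) • f₁ u + (1 / 4 * t₂) • f₂ u +
          (1 / 2 : ℝ) • f₁ (F u) + (1 / 2 : ℝ) • F (f₁ u) - c • f₁ u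
  let E₂ : Γ → Γ := fun u => (1 / 4 * t₃) • f₂ u + (1 / 4 * t₂) • f₁ u +
          (1 / 2 : ℝ) • f₂ (F u) + (1 / 2 : ℝ) • F (f₂ u) - c • f₂ u
  have key : ∀ u v : Γ, bra (D u) v + bra u (D v) - D (bra u v) =
      ⟪(E₁ u : g), (v : g)⟫ • e₁ + ⟪(E₂ u : g), (v : g)⟫ • e₂ := by
    intro u v
    rw [hDu, hDu, hf, hf, hf, map_add, map_smul, map_smul, hDe₁, hDe₂]
    simp only [E₁, E₂, map_sub, map_smul, Submodule.coe_add, Submodule.coe_sub,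
      Submodule.coe_smul, inner_add_left, inner_sub_left, inner_sub_right,
      real_inner_smul_left, real_inner_smul_right, hFsym]
    module
  have h11 : ⟪e₁, e₁⟫ = 1 := by rw [real_inner_self_eq_norm_sq, he₁]; norm_num
  have h22 : ⟪e₂, e₂⟫ = 1 := by rw [real_inner_self_eq_norm_sq, he₂]; norm_num
  have h21 : ⟪e₂, e₁⟫ = 0 := by rw [real_inner_comm, he₁₂]
  constructor
  · intro h u
    have hk : ∀ v : Γ, ⟪(E₁ u : g), (v : g)⟫ = 0 ∧ ⟪(E₂ u : g), (v : g)⟫ = 0 := by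
      intro v
      have hz := key u v
      rw [h u v, sub_self] at hz
      constructor
      · have := congrArg (fun x => ⟪e₁, x⟫) hz
        simp only [inner_add_right, real_inner_smul_right, h11, he₁₂, inner_zero_right] at this
        linarith
      · have := congrArg (fun x => ⟪e₂, x⟫) hz
        simp only [inner_add_right, real_inner_smul_right, h22, h21, inner_zero_right] at this
        linarith
    have h1 : E₁ u = 0 := Subtype.ext (inner_self_eq_zero.1 (hk (E₁ u)).1)
    have h2 : E₂ u = 0 := Subtype.ext (inner_self_eq_zero.1 (hk (E₂ u)).2)
    exact ⟨(sub_eq_zero.1 h1).symm, (sub_eq_zero.1 h2).symm⟩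
  · intro h x y
    have huv : ∀ u v : Γ, D (bra u v) = bra (D u) v + bra u (D v) := by
      intro u v
      have h1 : E₁ u = 0 := sub_eq_zero.2 (h u).1.symm
      have h2 : E₂ u = 0 := sub_eq_zero.2 (h u).2.symm
      have hz := key u v
      rw [h1, h2] at hz
      simp only [Submodule.coe_zero, inner_zero_left, zero_smul, add_zero] at hz
      exact (sub_eq_zero.1 hz).symm
    obtain ⟨p, q, u, rfl⟩ := hdec x
    obtain ⟨r, s, v, rfl⟩ := hdec y
    have := huv u v
    simp only [map_add, map_smul, LinearMap.add_apply, LinearMap.smul_apply, hDe₁, hDe₂,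
      hxe₁, hxe₂, hex₁, hex₂, smul_zero, zero_add, add_zero, map_zero]
    exact this
end

section
/- There do not exist a real number c and a derivation D of g such that Ric = c·id_g + D; that is, the left-invariant metric determined by ⟨·,·⟩ on the corresponding indecomposable Lie group of dimension 5+2k with two-dimensional commutator subgroup is not an algebraic Ricci soliton. -/
open scoped RealInnerProductSpace

/-- the indecomposable Lie algebra of dimension `n = 5 + 2k` with
two-dimensional commutator ideal (Example 1), with the metric making
`X₁, …, Xₙ` orthonormal (0-indexed below as `X 0, …, X (n-1)`), is not an algebraic
Ricci soliton: there are no `c : ℝ` and derivation `D` with `Ric = c·id + D`. -/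
theorem stmt_17 (k : ℕ) (n : ℕ) (hn : n = 5 + 2 * k)
    (X : Fin n → EuclideanSpace ℝ (Fin n))
    (hX : ∀ i : Fin n, X i = EuclideanSpace.single i 1)
    (bra : EuclideanSpace ℝ (Fin n) →ₗ[ℝ] EuclideanSpace ℝ (Fin n) →ₗ[ℝ]
      EuclideanSpace ℝ (Fin n))
    (hbra_alt : ∀ x, bra x x = 0)
    (hbra_jac : ∀ x y z, bra (bra x y) z + bra (bra y z) x + bra (bra z x) y = 0)
    -- `[X₃, X₄] = X₁` (0-indexed: `[X 2, X 3] = X 0`)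
    (hbr1 : ∀ i j l : Fin n, i.val = 2 → j.val = 3 → l.val = 0 → bra (X i) (X j) = X l)
    -- `[X₃, X₁] = X₂` (0-indexed: `[X 2, X 0] = X 1`)
    (hbr2 : ∀ i j l : Fin n, i.val = 2 → j.val = 0 → l.val = 1 → bra (X i) (X j) = X l)
    -- `[X₄, X₅] = [X₆, X₇] = ⋯ = [X_{4+2k}, X_{5+2k}] = X₂`
    (hbr3 : ∀ i j l : Fin n, 3 ≤ i.val → i.val % 2 = 1 → j.val = i.val + 1 →
      l.val = 1 → bra (X i) (X j) = X l)
    -- all other brackets of basis vectors vanish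
    (hbr0 : ∀ i j : Fin n,
      ¬ ((i.val = 2 ∧ j.val = 3) ∨ (i.val = 2 ∧ j.val = 0) ∨
          (3 ≤ i.val ∧ i.val % 2 = 1 ∧ j.val = i.val + 1)) →
      ¬ ((j.val = 2 ∧ i.val = 3) ∨ (j.val = 2 ∧ i.val = 0) ∨
          (3 ≤ j.val ∧ j.val % 2 = 1 ∧ i.val = j.val + 1)) →
      bra (X i) (X j) = 0)
    (Ric : EuclideanSpace ℝ (Fin n) →ₗ[ℝ] EuclideanSpace ℝ (Fin n))
    (hRic0 : ∀ i : Fin n, i.val = 0 → Ric (X i) = 0)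
    (hRic1 : ∀ i : Fin n, i.val = 1 → Ric (X i) = (((n : ℝ) + 1) / 4) • X i)
    (hRic2 : ∀ i : Fin n, i.val = 2 → Ric (X i) = -X i)
    (hRic3 : ∀ i : Fin n, i.val = 3 → Ric (X i) = -X i)
    (hRic4 : ∀ i : Fin n, 4 ≤ i.val → Ric (X i) = -(1 / 2 : ℝ) • X i) :
    ¬ ∃ (c : ℝ) (D : EuclideanSpace ℝ (Fin n) →ₗ[ℝ] EuclideanSpace ℝ (Fin n)),
        (∀ x y, D (bra x y) = bra (D x) y + bra x (D y)) ∧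
        Ric = c • (LinearMap.id : EuclideanSpace ℝ (Fin n) →ₗ[ℝ] EuclideanSpace ℝ (Fin n))
          + D := by
  rintro ⟨c, D, hD, hR⟩
  have key : ∀ (i j l : Fin n) (a b d : ℝ), bra (X i) (X j) = X l → Ric (X i) = a • X i →
      Ric (X j) = b • X j → Ric (X l) = d • X l → d - c = (a - c) + (b - c) := by
    intro i j l a b d hb hi hj hl
    have hDe : ∀ (m : Fin n) (e : ℝ), Ric (X m) = e • X m → D (X m) = (e - c) • X m := by
      intro m e hm
      rw [hR, LinearMap.add_apply, LinearMap.smul_apply, LinearMap.id_apply] at hm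
      rw [sub_smul, ← hm, add_sub_cancel_left]
    have h := hD (X i) (X j)
    rw [hb, hDe i a hi, hDe j b hj, hDe l d hl, map_smul, map_smul, LinearMap.smul_apply, hb,
      ← add_smul] at h
    have h2 := congrArg (fun v : EuclideanSpace ℝ (Fin n) => v l) h
    simpa [hX] using h2
  have h0 := key ⟨2, by omega⟩ ⟨3, by omega⟩ ⟨0, by omega⟩ (-1) (-1) 0 (hbr1 _ _ _ rfl rfl rfl)
    (by rw [hRic2 _ rfl, neg_one_smul]) (by rw [hRic3 _ rfl, neg_one_smul])
    (by rw [hRic0 _ rfl, zero_smul])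
  have h1 := key ⟨2, by omega⟩ ⟨0, by omega⟩ ⟨1, by omega⟩ (-1) 0 _ (hbr2 _ _ _ rfl rfl rfl)
    (by rw [hRic2 _ rfl, neg_one_smul]) (by rw [hRic0 _ rfl, zero_smul]) (hRic1 _ rfl)
  have h5 : (5 : ℝ) ≤ n := by exact_mod_cast (by omega : 5 ≤ n)
  linarith
end

section
/- There do not exist a real number c and a derivation D of g such that Ric = c·id_g + D; that is, the left-invariant metric determined by ⟨·,·⟩ on the corresponding indecomposable Lie group of dimension 6+2k with two-dimensional commutator subgroup (first type) is not an algebraic Ricci soliton. -/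
open scoped RealInnerProductSpace

/-- the first-type indecomposable Lie algebra of dimension `n = 6 + 2k`
with two-dimensional commutator ideal (Example 2), with the metric making
`X₁, …, Xₙ` orthonormal (0-indexed below as `X 0, …, X (n-1)`), is not an algebraic
Ricci soliton: there are no `c : ℝ` and derivation `D` with `Ric = c·id + D`. -/
theorem stmt_18 (k : ℕ) (n : ℕ) (hn : n = 6 + 2 * k)
    (X : Fin n → EuclideanSpace ℝ (Fin n))
    (hX : ∀ i : Fin n, X i = EuclideanSpace.single i 1)
    (bra : EuclideanSpace ℝ (Fin n) →ₗ[ℝ] EuclideanSpace ℝ (Fin n) →ₗ[ℝ]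
      EuclideanSpace ℝ (Fin n))
    (hbra_alt : ∀ x, bra x x = 0)
    (hbra_jac : ∀ x y z, bra (bra x y) z + bra (bra y z) x + bra (bra z x) y = 0)
    -- `[X₃, X₁] = X₁` (0-indexed: `[X 2, X 0] = X 0`)
    (hbr1 : ∀ i j : Fin n, i.val = 2 → j.val = 0 → bra (X i) (X j) = X j)
    -- `[X₃, X₄] = X₂` (0-indexed: `[X 2, X 3] = X 1`)
    (hbr2 : ∀ i j l : Fin n, i.val = 2 → j.val = 3 → l.val = 1 → bra (X i) (X j) = X l)
    -- `[X₅, X₆] = [X₇, X₈] = ⋯ = [X_{5+2k}, X_{6+2k}] = X₂`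
    (hbr3 : ∀ i j l : Fin n, 4 ≤ i.val → i.val % 2 = 0 → j.val = i.val + 1 →
      l.val = 1 → bra (X i) (X j) = X l)
    -- all other brackets of basis vectors vanish
    (hbr0 : ∀ i j : Fin n,
      ¬ ((i.val = 2 ∧ j.val = 0) ∨ (i.val = 2 ∧ j.val = 3) ∨
          (4 ≤ i.val ∧ i.val % 2 = 0 ∧ j.val = i.val + 1)) →
      ¬ ((j.val = 2 ∧ i.val = 0) ∨ (j.val = 2 ∧ i.val = 3) ∨
          (4 ≤ j.val ∧ j.val % 2 = 0 ∧ i.val = j.val + 1)) →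
      bra (X i) (X j) = 0)
    (Ric : EuclideanSpace ℝ (Fin n) →ₗ[ℝ] EuclideanSpace ℝ (Fin n))
    (hRic0 : ∀ i : Fin n, i.val = 0 → Ric (X i) = -X i)
    (hRic1 : ∀ i j : Fin n, i.val = 1 → j.val = 3 →
      Ric (X i) = ((n : ℝ) / 4) • X i - (1 / 2 : ℝ) • X j)
    (hRic2 : ∀ i : Fin n, i.val = 2 → Ric (X i) = -(3 / 2 : ℝ) • X i)
    (hRic3 : ∀ i j : Fin n, i.val = 3 → j.val = 1 →
      Ric (X i) = -((1 / 2 : ℝ) • X j) - (1 / 2 : ℝ) • X i)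
    (hRic4 : ∀ i : Fin n, 4 ≤ i.val → Ric (X i) = -(1 / 2 : ℝ) • X i) :
    ¬ ∃ (c : ℝ) (D : EuclideanSpace ℝ (Fin n) →ₗ[ℝ] EuclideanSpace ℝ (Fin n)),
        (∀ x y, D (bra x y) = bra (D x) y + bra x (D y)) ∧
        Ric = c • (LinearMap.id : EuclideanSpace ℝ (Fin n) →ₗ[ℝ] EuclideanSpace ℝ (Fin n))
          + D := by
  rintro ⟨c, D, hD, hR⟩
  have h1 : 1 < n := by omega
  have h2 : 2 < n := by omega
  have h3 : 3 < n := by omega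
  have hDx : ∀ x, D x = Ric x - c • x := by
    intro x
    rw [hR]
    simp
  have b23 := hbr2 ⟨2, h2⟩ ⟨3, h3⟩ ⟨1, h1⟩ rfl rfl rfl
  have b21 : bra (X ⟨2, h2⟩) (X ⟨1, h1⟩) = 0 := by
    apply hbr0 <;> simp
  have key := hD (X ⟨2, h2⟩) (X ⟨3, h3⟩)
  rw [b23, hDx, hDx, hDx, hRic1 ⟨1, h1⟩ ⟨3, h3⟩ rfl rfl, hRic2 ⟨2, h2⟩ rfl,
    hRic3 ⟨3, h3⟩ ⟨1, h1⟩ rfl rfl] at key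
  simp only [map_sub, map_smul, map_neg, LinearMap.sub_apply, LinearMap.smul_apply,
    LinearMap.neg_apply, b23, b21] at key
  have k3 := congrArg (fun v : EuclideanSpace ℝ (Fin n) => v ⟨3, h3⟩) key
  simp [hX] at k3
end

section
/- There do not exist a real number c and a derivation D of g such that Ric = c·id_g + D; that is, the left-invariant metric determined by ⟨·,·⟩ on the corresponding indecomposable Lie group of dimension 6+2k with two-dimensional commutator subgroup (second type) is not an algebraic Ricci soliton. -/
open scoped RealInnerProductSpace

/-- the second-type indecomposable Lie algebra of dimension `n = 6 + 2k`
with two-dimensional commutator ideal (Example 3), with the metric making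
`X₁, …, Xₙ` orthonormal (0-indexed below as `X 0, …, X (n-1)`), is not an algebraic
Ricci soliton: there are no `c : ℝ` and derivation `D` with `Ric = c·id + D`. -/
theorem stmt_19 (k : ℕ) (n : ℕ) (hn : n = 6 + 2 * k)
    (X : Fin n → EuclideanSpace ℝ (Fin n))
    (hX : ∀ i : Fin n, X i = EuclideanSpace.single i 1)
    (bra : EuclideanSpace ℝ (Fin n) →ₗ[ℝ] EuclideanSpace ℝ (Fin n) →ₗ[ℝ]
      EuclideanSpace ℝ (Fin n))
    (hbra_alt : ∀ x, bra x x = 0)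
    (hbra_jac : ∀ x y z, bra (bra x y) z + bra (bra y z) x + bra (bra z x) y = 0)
    -- `[X₃, X₄] = X₁` (0-indexed: `[X 2, X 3] = X 0`)
    (hbr1 : ∀ i j l : Fin n, i.val = 2 → j.val = 3 → l.val = 0 → bra (X i) (X j) = X l)
    -- `[X₃, X₁] = X₂` (0-indexed: `[X 2, X 0] = X 1`)
    (hbr2 : ∀ i j l : Fin n, i.val = 2 → j.val = 0 → l.val = 1 → bra (X i) (X j) = X l)
    -- `[X₅, X₆] = [X₇, X₈] = ⋯ = [X_{5+2k}, X_{6+2k}] = X₂`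
    (hbr3 : ∀ i j l : Fin n, 4 ≤ i.val → i.val % 2 = 0 → j.val = i.val + 1 →
      l.val = 1 → bra (X i) (X j) = X l)
    -- all other brackets of basis vectors vanish
    (hbr0 : ∀ i j : Fin n,
      ¬ ((i.val = 2 ∧ j.val = 3) ∨ (i.val = 2 ∧ j.val = 0) ∨
          (4 ≤ i.val ∧ i.val % 2 = 0 ∧ j.val = i.val + 1)) →
      ¬ ((j.val = 2 ∧ i.val = 3) ∨ (j.val = 2 ∧ i.val = 0) ∨
          (4 ≤ j.val ∧ j.val % 2 = 0 ∧ i.val = j.val + 1)) →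
      bra (X i) (X j) = 0)
    (Ric : EuclideanSpace ℝ (Fin n) →ₗ[ℝ] EuclideanSpace ℝ (Fin n))
    (hRic0 : ∀ i : Fin n, i.val = 0 → Ric (X i) = 0)
    (hRic1 : ∀ i : Fin n, i.val = 1 → Ric (X i) = (((k : ℝ) + 3) / 2) • X i)
    (hRic2 : ∀ i : Fin n, i.val = 2 → Ric (X i) = -X i)
    (hRic3 : ∀ i : Fin n, 3 ≤ i.val → Ric (X i) = -(1 / 2 : ℝ) • X i) :
    ¬ ∃ (c : ℝ) (D : EuclideanSpace ℝ (Fin n) →ₗ[ℝ] EuclideanSpace ℝ (Fin n)),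
        (∀ x y, D (bra x y) = bra (D x) y + bra x (D y)) ∧
        Ric = c • (LinearMap.id : EuclideanSpace ℝ (Fin n) →ₗ[ℝ] EuclideanSpace ℝ (Fin n))
          + D := by
  rintro ⟨c, D, hD, hR⟩
  have key : ∀ (i j l : Fin n) (a b d : ℝ), Ric (X i) = a • X i → Ric (X j) = b • X j →
      Ric (X l) = d • X l → bra (X i) (X j) = X l → d = a + b - c := by
    intro i j l a b d hi hj hl h
    have hDx : ∀ (m : Fin n) (r : ℝ), Ric (X m) = r • X m → D (X m) = (r - c) • X m := by
      intro m r hm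
      rw [hR] at hm
      simp only [LinearMap.add_apply, LinearMap.smul_apply, LinearMap.id_apply] at hm
      rw [sub_smul, ← hm]
      abel
    have e := hD (X i) (X j)
    rw [h, hDx i a hi, hDx j b hj, hDx l d hl] at e
    simp only [map_smul, LinearMap.smul_apply, h] at e
    rw [← add_smul] at e
    have e2 := congrArg (fun v : EuclideanSpace ℝ (Fin n) => v l) e
    simp [hX] at e2
    linarith
  have r0 := hRic0 ⟨0, by omega⟩ rfl
  have r1 := hRic1 ⟨1, by omega⟩ rfl
  have r2 := hRic2 ⟨2, by omega⟩ rfl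
  have r3 := hRic3 ⟨3, by omega⟩ le_rfl
  rw [← zero_smul ℝ (X ⟨0, by omega⟩)] at r0
  rw [← neg_one_smul ℝ] at r2
  have h1 := key _ _ _ _ _ _ r2 r3 r0 (hbr1 _ _ _ rfl rfl rfl)
  have h2 := key _ _ _ _ _ _ r2 r0 r1 (hbr2 _ _ _ rfl rfl rfl)
  have hk : (0 : ℝ) ≤ k := Nat.cast_nonneg k
  linarith
end
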